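/- arXiv:2412.00788 — 2 statements merged into one kernel-verified Lean document; each statement's English description precedes it below -/
import Mathlib

section
/- Let n ≥ 1, let C₀ > 0 and M > 0, and suppose u satisfies Δu = q·u in B(0,10) ⊂ ℝⁿ with ‖u‖_{L^∞(B(0,10))} ≤ C₀ and ‖q‖_{L^∞(B(0,10))} ≤ M. If for each N > 0 there is a constant C_N with |u(x)| ≤ C_N |x|^N for all x ∈ B(0,10), then u ≡ 0 in B(0,10). -/
open MeasureTheory Real

/-- The Laplacian of a complex-valued function on `ℝⁿ`. -/
noncomputable def laplacian {n : ℕ} (u : EuclideanSpace ℝ (Fin n) → ℂ)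
    (x : EuclideanSpace ℝ (Fin n)) : ℂ :=
  ∑ i : Fin n, fderiv ℝ (fun y => fderiv ℝ u y (EuclideanSpace.single i 1)) x
    (EuclideanSpace.single i 1)

theorem frequency_numerator_bound {r R M h h' Q Q' S : ℝ} (hr : 0 < r) (hrR : r ≤ R) (hM : 0 < M)
    (hh : 0 ≤ h) (hQ : 0 ≤ Q) (hh' : |h'| ≤ 2 * S) (hQh : |2 * r * h' - Q| ≤ r ^ 2 * M * h)
    (hQ' : 8 * r * S ^ 2 - 2 * r ^ 2 * M * S * h ≤ Q' * h) :
    -(R * M) * (Q * h + 2 * R ^ 2 * M * h ^ 2) ≤ Q' * h - Q * h' := by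
  obtain ⟨hQh1, hQh2⟩ := abs_le.1 hQh
  have hS : 0 ≤ S := by linarith [abs_nonneg h']
  have key : -(r * M) * (Q * h + 2 * r ^ 2 * M * h ^ 2) ≤ Q' * h - Q * h' := by
    set a := |h'| with ha
    have ha0 : 0 ≤ a := abs_nonneg h'
    have hsq : h' ^ 2 = a ^ 2 := (sq_abs h').symm
    have hQa : 2 * r * a ≤ Q + r ^ 2 * M * h := by
      rcases abs_cases h' with ⟨h1, _⟩ | ⟨h1, _⟩ <;> rw [ha, h1] <;> nlinarith
    have h1 : Q * h' ≤ 2 * r * a ^ 2 + r ^ 2 * M * h * a := by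
      have : (Q - 2 * r * h') * h' ≤ r ^ 2 * M * h * a := by
        calc (Q - 2 * r * h') * h' ≤ |(Q - 2 * r * h') * h'| := le_abs_self _
          _ = |2 * r * h' - Q| * a := by rw [abs_mul, abs_sub_comm]
          _ ≤ _ := by gcongr
      nlinarith
    have h2 : r * (2 * S + a) * (2 * (2 * S - a) - r * M * h) ≤ Q' * h - Q * h' := by nlinarith
    have hrMh : 0 ≤ r * M * h := by positivity
    refine le_trans ?_ h2
    rcases le_total (r * M * h) (2 * (2 * S - a)) with h3 | h3
    · have : 0 ≤ r * (2 * S + a) * (2 * (2 * S - a) - r * M * h) :=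
        mul_nonneg (by positivity) (by linarith)
      have : 0 ≤ (r * M) * (Q * h + 2 * r ^ 2 * M * h ^ 2) := by positivity
      linarith
    · have h4 : r * (2 * S + a) ≤ Q + 2 * r ^ 2 * M * h := by
        have : r * (2 * S + a) ≤ r * (2 * a + r * M * h / 2) :=
          mul_le_mul_of_nonneg_left (by linarith) hr.le
        have : 0 ≤ r * (r * M * h) := by positivity
        nlinarith
      have h5 : r * (2 * S + a) * (2 * (2 * S - a) - r * M * h)
          ≥ r * (2 * S + a) * (- (r * M * h)) := by
        have : 0 ≤ r * (2 * S + a) := by positivity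
        exact mul_le_mul_of_nonneg_left (by linarith) this
      nlinarith [mul_le_mul_of_nonneg_right h4 hrMh]
  refine le_trans ?_ key
  have : (r * M) * (Q * h + 2 * r ^ 2 * M * h ^ 2) ≤ (R * M) * (Q * h + 2 * R ^ 2 * M * h ^ 2) := by
    have hR : 0 < R := hr.trans_le hrR
    gcongr
  linarith

/-- Almost monotonicity of the frequency `Q / h` forces `h` to decay at most polynomially at `0`. -/
theorem exists_pow_le_of_frequency {R M : ℝ} (hR : 0 < R) (hM : 0 < M) {h h' Q Q' S : ℝ → ℝ}
    (dh : ∀ r, HasDerivAt h (h' r) r) (dQ : ∀ r, HasDerivAt Q (Q' r) r)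
    (hh : ∀ r, 0 ≤ h r) (hQ : ∀ r, 0 ≤ Q r)
    (hh' : ∀ r, 0 < r → r ≤ R → |h' r| ≤ 2 * S r)
    (hQh : ∀ r, 0 < r → r ≤ R → |2 * r * h' r - Q r| ≤ r ^ 2 * M * h r)
    (hQ' : ∀ r, 0 < r → r ≤ R → 8 * r * S r ^ 2 - 2 * r ^ 2 * M * S r * h r ≤ Q' r * h r)
    (hpos : 0 < h R) :
    ∃ k : ℕ, ∃ c : ℝ, 0 < c ∧ ∀ r, 0 < r → r ≤ R → c * r ^ k ≤ h r := by
  set Λ : ℝ := (Q R / h R + 2 * R ^ 2 * M) * exp (R * M * R) with hΛ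
  have hΛ0 : 0 ≤ Λ := by have := hQ R; positivity
  obtain ⟨k, hk⟩ := exists_nat_ge (Λ + R ^ 2 * M)
  have hc : 0 < h R / R ^ k := by positivity
  have main : ∀ ρ, 0 < ρ → ρ ≤ R → (∀ r ∈ Set.Icc ρ R, 0 < h r) → h R / R ^ k * ρ ^ k ≤ h ρ := by
    intro ρ hρ hρR hp
    have hN : ∀ r ∈ Set.Icc ρ R, Q r ≤ Λ * h r := by
      have dF : ∀ r ∈ Set.Icc ρ R,
          HasDerivAt (fun r => (Q r / h r + 2 * R ^ 2 * M) * exp (R * M * r))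
            ((Q' r * h r - Q r * h' r) / h r ^ 2 * exp (R * M * r)
              + (Q r / h r + 2 * R ^ 2 * M) * (exp (R * M * r) * (R * M))) r := by
        intro r hr
        have h1 := ((dQ r).div (dh r) (hp r hr).ne').add_const (2 * R ^ 2 * M)
        have h2 : HasDerivAt (fun r => exp (R * M * r)) (exp (R * M * r) * (R * M)) r := by
          simpa using ((hasDerivAt_id r).const_mul (R * M)).exp
        exact h1.mul h2
      have mono : MonotoneOn (fun r => (Q r / h r + 2 * R ^ 2 * M) * exp (R * M * r))
          (Set.Icc ρ R) := by
        refine monotoneOn_of_deriv_nonneg (convex_Icc _ _)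
          (fun r hr => (dF r hr).continuousAt.continuousWithinAt)
          (fun r hr => (dF r (interior_subset hr)).differentiableAt.differentiableWithinAt) ?_
        intro r hr
        have hr := interior_subset hr
        rw [(dF r hr).deriv]
        have hr0 : 0 < r := hρ.trans_le hr.1
        have hb := frequency_numerator_bound hr0 hr.2 hM (hh r) (hQ r) (hh' r hr0 hr.2)
          (hQh r hr0 hr.2) (hQ' r hr0 hr.2)
        have hhr := hp r hr
        have : (Q' r * h r - Q r * h' r) / h r ^ 2 * exp (R * M * r)
              + (Q r / h r + 2 * R ^ 2 * M) * (exp (R * M * r) * (R * M))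
            = ((Q' r * h r - Q r * h' r) + (R * M) * (Q r * h r + 2 * R ^ 2 * M * h r ^ 2))
              / h r ^ 2 * exp (R * M * r) := by
          field_simp
        rw [this]
        have : 0 ≤ (Q' r * h r - Q r * h' r) + (R * M) * (Q r * h r + 2 * R ^ 2 * M * h r ^ 2) := by
          linarith
        positivity
      intro r hr
      have h1 := mono hr (Set.right_mem_Icc.2 hρR) hr.2
      have hr0 : 0 < r := hρ.trans_le hr.1
      have hhr := hp r hr
      have h2 : Q r / h r ≤ Λ := by
        have h3 : 0 ≤ Q r / h r := div_nonneg (hQ r) (hh r)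
        have h4 : 1 ≤ exp (R * M * r) := one_le_exp (by positivity)
        have h5 : 0 < 2 * R ^ 2 * M := by positivity
        have h6 : (Q r / h r + 2 * R ^ 2 * M) * 1
            ≤ (Q r / h r + 2 * R ^ 2 * M) * exp (R * M * r) := by gcongr
        simp only at h1
        linarith
      exact (div_le_iff₀ hhr).1 h2
    have dG : ∀ r ∈ Set.Icc ρ R, HasDerivAt (fun r => h r / r ^ k)
        ((h' r * r ^ k - h r * (k * r ^ (k - 1))) / (r ^ k) ^ 2) r := by
      intro r hr
      have hr0 : 0 < r := hρ.trans_le hr.1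
      exact (dh r).div (hasDerivAt_pow k r) (by positivity)
    have anti : AntitoneOn (fun r => h r / r ^ k) (Set.Icc ρ R) := by
      refine antitoneOn_of_deriv_nonpos (convex_Icc _ _)
          (fun r hr => (dG r hr).continuousAt.continuousWithinAt)
          (fun r hr => (dG r (interior_subset hr)).differentiableAt.differentiableWithinAt) ?_
      intro r hr
      have hr := interior_subset hr
      rw [(dG r hr).deriv]
      have hr0 : 0 < r := hρ.trans_le hr.1
      refine div_nonpos_of_nonpos_of_nonneg ?_ (by positivity)
      have hhr := hp r hr
      have h1 := hN r hr
      have h2 := (abs_le.1 (hQh r hr0 hr.2)).2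
      have h3 : r ^ 2 * M * h r ≤ R ^ 2 * M * h r := by
        gcongr
        exact hr.2
      have h4 : (Λ + R ^ 2 * M) * h r ≤ k * h r := by gcongr
      have h5 : 0 ≤ k * h r := by positivity
      have h6 : h' r * r ≤ k * h r := by nlinarith
      rcases Nat.eq_zero_or_pos k with rfl | hk0
      · simp at h6 ⊢
        nlinarith
      · have : r ^ k = r * r ^ (k - 1) := by
          rw [← pow_succ', Nat.sub_add_cancel hk0]
        rw [this]
        have : (h' r * r) * r ^ (k - 1) ≤ (k * h r) * r ^ (k - 1) := by gcongr
        nlinarith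
    have h1 := anti (Set.left_mem_Icc.2 hρR) (Set.right_mem_Icc.2 hρR) hρR
    exact (le_div_iff₀ (by positivity)).1 h1
  have hcont : Continuous h := continuous_iff_continuousAt.2 fun r => (dh r).continuousAt
  have pos : ∀ r, 0 < r → r ≤ R → 0 < h r := by
    intro t ht htR
    by_contra hcon
    have hzero : h t = 0 := le_antisymm (not_lt.1 hcon) (hh t)
    have hcomp : IsCompact (Set.Icc t R ∩ h ⁻¹' {0}) :=
      isCompact_Icc.inter_right (isClosed_singleton.preimage hcont)
    obtain ⟨s, ⟨⟨hts, hsR⟩, hs0⟩, hmax⟩ := hcomp.exists_isGreatest ⟨t, ⟨le_rfl, htR⟩, hzero⟩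
    have hs0 : h s = 0 := hs0
    have hslt : s < R := lt_of_le_of_ne hsR (by rintro rfl; linarith)
    have hsp : 0 < s := ht.trans_le hts
    have hbd : ∀ ρ ∈ Set.Ioc s R, h R / R ^ k * ρ ^ k ≤ h ρ := by
      intro ρ hρ
      refine main ρ (hsp.trans hρ.1) hρ.2 fun r hr => lt_of_le_of_ne (hh r) fun he => ?_
      have := hmax ⟨⟨(hts.trans hρ.1.le).trans hr.1, hr.2⟩, he.symm⟩
      linarith [hr.1, hρ.1]
    have hle : h R / R ^ k * s ^ k ≤ h s := by
      have hcl : s ∈ closure (Set.Ioc s R) := by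
        rw [closure_Ioc hslt.ne]; exact ⟨le_rfl, hsR⟩
      exact le_on_closure hbd (by fun_prop) hcont.continuousOn hcl
    have : 0 < h R / R ^ k * s ^ k := by positivity
    linarith
  exact ⟨k, h R / R ^ k, hc, fun r hr hrR =>
    main r hr hrR fun t ht => pos t (hr.trans_le ht.1) ht.2⟩

/-- The weight `(1 - |y|²)₊`. -/
noncomputable def ballWeight {E : Type*} [NormedAddCommGroup E] (y : E) : ℝ :=
  max (1 - ‖y‖ ^ 2) 0

section Weight

variable {E : Type*} [NormedAddCommGroup E]

theorem continuous_ballWeight : Continuous (ballWeight : E → ℝ) := by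
  unfold ballWeight; fun_prop

theorem ballWeight_nonneg (y : E) : 0 ≤ ballWeight y := le_max_right _ _

theorem ballWeight_le_one (y : E) : ballWeight y ≤ 1 :=
  max_le (by nlinarith [sq_nonneg ‖y‖]) zero_le_one

theorem ballWeight_sq_le (y : E) : ballWeight y ^ 2 ≤ ballWeight y := by
  nlinarith [ballWeight_nonneg y, ballWeight_le_one y]

theorem ballWeight_eq_zero {y : E} (hy : 1 ≤ ‖y‖) : ballWeight y = 0 :=
  max_eq_right (by nlinarith)

theorem ballWeight_pos {y : E} (hy : ‖y‖ < 1) : 0 < ballWeight y :=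
  lt_max_of_lt_left (by nlinarith [norm_nonneg y])

theorem hasDerivAt_max_zero_sq (t : ℝ) :
    HasDerivAt (fun t : ℝ => max t 0 ^ 2) (2 * max t 0) t := by
  rcases lt_trichotomy t 0 with h | rfl | h
  · rw [max_eq_right h.le, mul_zero]
    refine (hasDerivAt_const t (0 : ℝ)).congr_of_eventuallyEq ?_
    filter_upwards [gt_mem_nhds h] with s hs
    simp [max_eq_right hs.le]
  · rw [max_self, mul_zero, hasDerivAt_iff_isLittleO]
    have h2 : (fun t : ℝ => t ^ 2) =o[nhds 0] fun t : ℝ => t := by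
      simpa using Asymptotics.isLittleO_pow_pow (𝕜 := ℝ) (m := 1) (n := 2) (by norm_num)
    refine (Asymptotics.IsBigO.of_bound 1 ?_).trans_isLittleO
      (h2.congr_right fun t => (sub_zero t).symm)
    filter_upwards with s
    have : |max s 0| ≤ |s| := by
      rw [abs_of_nonneg (le_max_right s 0)]
      exact max_le (le_abs_self s) (abs_nonneg s)
    simpa using sq_le_sq.2 (by simpa using this)
  · rw [max_eq_left h.le]
    have := hasDerivAt_pow 2 t
    refine (this.congr_of_eventuallyEq ?_).congr_deriv (by simp)
    filter_upwards [lt_mem_nhds h] with s hs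
    simp [max_eq_left hs.le]

theorem hasFDerivAt_ballWeight_sq [InnerProductSpace ℝ E] (y : E) :
    HasFDerivAt (fun y : E => ballWeight y ^ 2) (-(4 * ballWeight y) • innerSL ℝ y) y := by
  have h1 : HasFDerivAt (fun y : E => 1 - ‖y‖ ^ 2) (-(2 • innerSL ℝ y)) y :=
    (hasStrictFDerivAt_norm_sq y).hasFDerivAt.const_sub 1
  refine ((hasDerivAt_max_zero_sq _).comp_hasFDerivAt y h1).congr_fderiv ?_
  ext v
  simp [ballWeight]
  ring

theorem integrable_mul_ballWeight_pow [MeasurableSpace E] [BorelSpace E] [ProperSpace E]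
    {μ : Measure E} [IsFiniteMeasureOnCompacts μ] {f : E → ℝ} (hf : Continuous f) {k : ℕ}
    (hk : k ≠ 0) : Integrable (fun y => f y * ballWeight y ^ k) μ := by
  refine (hf.mul (continuous_ballWeight.pow k)).integrable_of_hasCompactSupport ?_
  refine HasCompactSupport.intro (isCompact_closedBall (0 : E) 1) fun y hy => ?_
  have : 1 ≤ ‖y‖ := by simpa using (not_le.1 (mt mem_closedBall_zero_iff.2 hy)).le
  simp [ballWeight_eq_zero this, hk]

theorem hasDerivAt_integral_mul_ballWeight_pow [MeasurableSpace E] [BorelSpace E] [ProperSpace E]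
    {μ : Measure E} [IsFiniteMeasureOnCompacts μ] {F F' : ℝ → E → ℝ}
    (hF : ∀ r, Continuous (F r)) (hF' : Continuous (fun p : ℝ × E => F' p.1 p.2))
    (hd : ∀ r y, HasDerivAt (fun r => F r y) (F' r y) r) {k : ℕ} (hk : k ≠ 0) (r : ℝ) :
    HasDerivAt (fun r => ∫ y, F r y * ballWeight y ^ k ∂μ)
      (∫ y, F' r y * ballWeight y ^ k ∂μ) r := by
  have hF'r : ∀ r, Continuous (F' r) := fun r => hF'.comp (by fun_prop : Continuous fun y => (r, y))
  obtain ⟨C, hC⟩ := ((isCompact_closedBall r 1).prod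
    (isCompact_closedBall (0 : E) 1)).exists_bound_of_continuousOn hF'.continuousOn
  refine (hasDerivAt_integral_of_dominated_loc_of_deriv_le
    (bound := fun y => C * ballWeight y ^ k) (Metric.closedBall_mem_nhds r one_pos)
    (.of_forall fun s => (integrable_mul_ballWeight_pow (hF s) hk).aestronglyMeasurable)
    (integrable_mul_ballWeight_pow (hF r) hk)
    (integrable_mul_ballWeight_pow (hF'r r) hk).aestronglyMeasurable
    (.of_forall fun y s hs => ?_) (integrable_mul_ballWeight_pow continuous_const hk)
    (.of_forall fun y s _ => (hd s y).mul_const _)).2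
  rcases le_total ‖y‖ 1 with hy | hy
  · rw [norm_mul, norm_of_nonneg (pow_nonneg (ballWeight_nonneg y) k)]
    gcongr
    · exact pow_nonneg (ballWeight_nonneg y) k
    · exact hC (s, y) ⟨hs, by simpa using hy⟩
  · simp [ballWeight_eq_zero hy, hk]

end Weight

theorem sq_integral_mul_mul_le {α : Type*} [MeasurableSpace α] {μ : Measure α} {f g w : α → ℝ}
    (hw : ∀ x, 0 ≤ w x) (hff : Integrable (fun x => f x ^ 2 * w x) μ)
    (hfg : Integrable (fun x => f x * g x * w x) μ)
    (hgg : Integrable (fun x => g x ^ 2 * w x) μ) :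
    (∫ x, f x * g x * w x ∂μ) ^ 2 ≤ (∫ x, f x ^ 2 * w x ∂μ) * ∫ x, g x ^ 2 * w x ∂μ := by
  have key : ∀ t : ℝ, 0 ≤ (∫ x, f x ^ 2 * w x ∂μ) * (t * t)
      + (2 * ∫ x, f x * g x * w x ∂μ) * t + ∫ x, g x ^ 2 * w x ∂μ := by
    intro t
    have h : 0 ≤ ∫ x, (t * f x + g x) ^ 2 * w x ∂μ :=
      integral_nonneg fun x => mul_nonneg (sq_nonneg _) (hw x)
    have e : ∀ x, (t * f x + g x) ^ 2 * w x
        = (t * t) * (f x ^ 2 * w x) + (2 * t) * (f x * g x * w x) + g x ^ 2 * w x := fun x => by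
      ring
    simp_rw [e] at h
    have hadd : Integrable
        (fun x => (t * t) * (f x ^ 2 * w x) + (2 * t) * (f x * g x * w x)) μ :=
      (hff.const_mul _).add (hfg.const_mul _)
    rw [integral_add hadd hgg,
      integral_add (hff.const_mul _) (hfg.const_mul _), integral_const_mul, integral_const_mul] at h
    linarith
  have := discrim_le_zero key
  rw [discrim] at this
  nlinarith

section Green

variable {n : ℕ}

local notation "𝔼" => EuclideanSpace ℝ (Fin n)

theorem integral_inner_fderiv_mul_ballWeight_sq {f g : 𝔼 → ℂ} (hf : ContDiff ℝ 1 f)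
    (hg : ContDiff ℝ 1 g) (i : Fin n) :
    ∫ y, inner ℝ (fderiv ℝ f y (EuclideanSpace.single i 1)) (g y) * ballWeight y ^ 2
      = 4 * (∫ y, inner ℝ (f y) (y i • g y) * ballWeight y ^ 1)
        - ∫ y, inner ℝ (f y) (fderiv ℝ g y (EuclideanSpace.single i 1)) * ballWeight y ^ 2 := by
  set e : 𝔼 := EuclideanSpace.single i 1
  have cf := hf.continuous
  have cg := hg.continuous
  have cf' : Continuous fun y => fderiv ℝ f y e :=
    (hf.continuous_fderiv one_ne_zero).clm_apply continuous_const
  have cg' : Continuous fun y => fderiv ℝ g y e :=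
    (hg.continuous_fderiv one_ne_zero).clm_apply continuous_const
  have df := hf.differentiable one_ne_zero
  have dg := hg.differentiable one_ne_zero
  have dW : ∀ y : 𝔼, fderiv ℝ (fun y : 𝔼 => ballWeight y ^ 2) y e = -(4 * ballWeight y) * y i := by
    intro y
    rw [(hasFDerivAt_ballWeight_sq y).fderiv]
    simp [e, EuclideanSpace.inner_single_right]
  have dfg : ∀ y, fderiv ℝ (fun y => inner ℝ (f y) (g y)) y e
      = inner ℝ (f y) (fderiv ℝ g y e) + inner ℝ (fderiv ℝ f y e) (g y) := fun y =>
    fderiv_inner_apply ℝ (df y) (dg y) e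
  have I1 : Integrable fun y => inner ℝ (fderiv ℝ f y e) (g y) * ballWeight y ^ 2 :=
    integrable_mul_ballWeight_pow (by fun_prop) two_ne_zero
  have I2 : Integrable fun y => inner ℝ (f y) (fderiv ℝ g y e) * ballWeight y ^ 2 :=
    integrable_mul_ballWeight_pow (by fun_prop) two_ne_zero
  have I3 : Integrable fun y : 𝔼 => inner ℝ (f y) (y i • g y) * ballWeight y ^ 1 :=
    integrable_mul_ballWeight_pow (by fun_prop) one_ne_zero
  have e1 : ∀ y, inner ℝ (f y) (g y) * fderiv ℝ (fun y : 𝔼 => ballWeight y ^ 2) y e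
      = (-4) * (inner ℝ (f y) (y i • g y) * ballWeight y ^ 1) := fun y => by
    rw [dW, inner_smul_right]; ring
  have e2 : ∀ y, fderiv ℝ (fun y => inner ℝ (f y) (g y)) y e * ballWeight y ^ 2
      = inner ℝ (f y) (fderiv ℝ g y e) * ballWeight y ^ 2
        + inner ℝ (fderiv ℝ f y e) (g y) * ballWeight y ^ 2 := fun y => by
    rw [dfg]; ring
  have ibp := integral_mul_fderiv_eq_neg_fderiv_mul_of_integrable (μ := volume)
    (f := fun y => inner ℝ (f y) (g y)) (g := fun y : 𝔼 => ballWeight y ^ 2) (v := e)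
    (by simp_rw [e2]; exact I2.add I1) (by simp_rw [e1]; exact I3.const_mul _)
    (integrable_mul_ballWeight_pow (by fun_prop) two_ne_zero)
    (fun y _ => (df y).inner ℝ (dg y)) (fun y _ => (hasFDerivAt_ballWeight_sq y).differentiableAt)
  simp_rw [e1, e2] at ibp
  rw [integral_const_mul, integral_add I2 I1] at ibp
  linarith

/-- Green's identity for the weight `(1 - |y|²)₊²`. -/
theorem sum_integral_inner_fderiv_mul_ballWeight_sq {f g : 𝔼 → ℂ} (hf : ContDiff ℝ 1 f)
    (hg : ContDiff ℝ 2 g) :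
    ∑ i, ∫ y, inner ℝ (fderiv ℝ f y (EuclideanSpace.single i 1))
        (fderiv ℝ g y (EuclideanSpace.single i 1)) * ballWeight y ^ 2
      = 4 * (∫ y, inner ℝ (f y) (fderiv ℝ g y y) * ballWeight y ^ 1)
        - ∫ y, inner ℝ (f y) (laplacian g y) * ballWeight y ^ 2 := by
  have cf := hf.continuous
  have hg1 : ∀ v : 𝔼, ContDiff ℝ 1 fun y => fderiv ℝ g y v := fun v =>
    (hg.fderiv_right (m := 1) (by norm_num)).clm_apply contDiff_const
  have cg1 : ∀ v : 𝔼, Continuous fun y => fderiv ℝ g y v := fun v => (hg1 v).continuous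
  have cg2 : ∀ v : 𝔼, Continuous fun y => fderiv ℝ (fun y => fderiv ℝ g y v) y v := fun v =>
    ((hg1 v).continuous_fderiv one_ne_zero).clm_apply continuous_const
  have hy : ∀ y : 𝔼, fderiv ℝ g y y = ∑ i, y i • fderiv ℝ g y (EuclideanSpace.single i 1) := by
    intro y
    generalize fderiv ℝ g y = L
    conv_lhs => rw [← (EuclideanSpace.basisFun (Fin n) ℝ).sum_repr y]
    simp
  have I1 : ∀ i : Fin n, Integrable fun y : 𝔼 =>
      inner ℝ (f y) (y i • fderiv ℝ g y (EuclideanSpace.single i 1)) * ballWeight y ^ 1 := fun i =>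
    have := cg1 (EuclideanSpace.single i 1)
    integrable_mul_ballWeight_pow (by fun_prop) one_ne_zero
  have I2 : ∀ i : Fin n, Integrable fun y : 𝔼 =>
      inner ℝ (f y) (fderiv ℝ (fun y => fderiv ℝ g y (EuclideanSpace.single i 1)) y
        (EuclideanSpace.single i 1)) * ballWeight y ^ 2 := fun i =>
    have := cg2 (EuclideanSpace.single i 1)
    integrable_mul_ballWeight_pow (by fun_prop) two_ne_zero
  simp_rw [hy, laplacian, inner_sum, Finset.sum_mul]
  rw [integral_finsetSum _ fun i _ => I1 i, integral_finsetSum _ fun i _ => I2 i,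
    Finset.mul_sum, ← Finset.sum_sub_distrib]
  exact Finset.sum_congr rfl fun i _ => integral_inner_fderiv_mul_ballWeight_sq hf (hg1 _) i

end Green

section Dilation

variable {n : ℕ} {u : EuclideanSpace ℝ (Fin n) → ℂ}

local notation "𝔼" => EuclideanSpace ℝ (Fin n)

theorem fderiv_comp_smul_apply (hu : Differentiable ℝ u) (r : ℝ) (y v : 𝔼) :
    fderiv ℝ (fun y => u (r • y)) y v = r • fderiv ℝ u (r • y) v := by
  have h : HasFDerivAt (fun y : 𝔼 => r • y) (r • ContinuousLinearMap.id ℝ 𝔼) y :=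
    (hasFDerivAt_id y).const_smul r
  have h1 : HasFDerivAt (fun y => u (r • y)) _ y := (hu (r • y)).hasFDerivAt.comp y h
  simp [h1.fderiv]

theorem laplacian_comp_smul (hu : ContDiff ℝ 2 u) (r : ℝ) (y : 𝔼) :
    laplacian (fun y => u (r • y)) y = r ^ 2 • laplacian u (r • y) := by
  have hu1 : ∀ v : 𝔼, Differentiable ℝ fun y => fderiv ℝ u y v := fun v =>
    ((hu.fderiv_right (m := 1) (by norm_num)).clm_apply contDiff_const).differentiable one_ne_zero
  have hu0 := hu.differentiable two_ne_zero
  simp only [laplacian, fderiv_comp_smul_apply hu0, Finset.smul_sum]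
  refine Finset.sum_congr rfl fun i _ => ?_
  set e : 𝔼 := EuclideanSpace.single i 1
  have h : DifferentiableAt ℝ (fun y : 𝔼 => fderiv ℝ u (r • y) e) y :=
    (hu1 e).differentiableAt.comp y (differentiableAt_id.const_smul r)
  rw [fderiv_fun_const_smul h]
  simp only [smul_apply]
  rw [fderiv_comp_smul_apply (hu1 e) r y e, smul_smul, sq]

theorem hasDerivAt_comp_smul (hu : Differentiable ℝ u) (r : ℝ) (y : 𝔼) :
    HasDerivAt (fun r : ℝ => u (r • y)) (fderiv ℝ u (r • y) y) r := by
  have h : HasDerivAt (fun r : ℝ => r • y) y r := by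
    simpa using (hasDerivAt_id r).smul_const y
  exact (hu (r • y)).hasFDerivAt.comp_hasDerivAt r h

theorem contDiff_fderiv_smul_apply (hu : ContDiff ℝ 2 u) (r : ℝ) :
    ContDiff ℝ 1 fun y : 𝔼 => fderiv ℝ u (r • y) y :=
  ((hu.fderiv_right (m := 1) (by norm_num)).comp (contDiff_const_smul r)).clm_apply contDiff_id

theorem fderiv_fderiv_smul_apply (hu : ContDiff ℝ 2 u) (r : ℝ) (y v : 𝔼) :
    fderiv ℝ (fun y => fderiv ℝ u (r • y) y) y v
      = fderiv ℝ u (r • y) v + r • fderiv ℝ (fderiv ℝ u) (r • y) v y := by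
  have hd : Differentiable ℝ (fderiv ℝ u) :=
    (hu.fderiv_right (m := 1) (by norm_num)).differentiable one_ne_zero
  have h : HasFDerivAt (fun y : 𝔼 => r • y) (r • ContinuousLinearMap.id ℝ 𝔼) y :=
    (hasFDerivAt_id y).const_smul r
  have h1 : HasFDerivAt (fun y : 𝔼 => fderiv ℝ u (r • y)) _ y :=
    (hd (r • y)).hasFDerivAt.comp y h
  have h2 : HasFDerivAt (fun y : 𝔼 => fderiv ℝ u (r • y) y) _ y :=
    h1.clm_apply (hasFDerivAt_id y)
  simp [h2.fderiv]

theorem hasDerivAt_fderiv_comp_smul (hu : ContDiff ℝ 2 u) (r : ℝ) (y v : 𝔼) :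
    HasDerivAt (fun r : ℝ => fderiv ℝ (fun y => u (r • y)) y v)
      (fderiv ℝ (fun y => fderiv ℝ u (r • y) y) y v) r := by
  have hd : Differentiable ℝ (fderiv ℝ u) :=
    (hu.fderiv_right (m := 1) (by norm_num)).differentiable one_ne_zero
  have h : HasDerivAt (fun r : ℝ => r • y) y r := by
    simpa using (hasDerivAt_id r).smul_const y
  have h1 : HasDerivAt (fun r : ℝ => fderiv ℝ u (r • y)) (fderiv ℝ (fderiv ℝ u) (r • y) y) r :=
    (hd (r • y)).hasFDerivAt.comp_hasDerivAt r h
  have h2 : HasDerivAt (fun r : ℝ => fderiv ℝ u (r • y) v)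
      (fderiv ℝ (fderiv ℝ u) (r • y) y v) r := by
    simpa using h1.clm_apply (hasDerivAt_const r v)
  have h3 : HasDerivAt (fun r : ℝ => r • fderiv ℝ u (r • y) v)
      (r • fderiv ℝ (fderiv ℝ u) (r • y) y v + (1 : ℝ) • fderiv ℝ u (r • y) v) r :=
    (hasDerivAt_id r).smul h2
  have hsymm : fderiv ℝ (fderiv ℝ u) (r • y) y v = fderiv ℝ (fderiv ℝ u) (r • y) v y :=
    (hu.contDiffAt.isSymmSndFDerivAt (by simp)).eq y v
  rw [fderiv_fderiv_smul_apply hu, ← hsymm, add_comm]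
  simpa only [fderiv_comp_smul_apply (hu.differentiable two_ne_zero), one_smul] using h3

theorem abs_integral_inner_laplacian_le (hu : ContDiff ℝ 2 u) {R M : ℝ}
    (hM : 0 ≤ M) (hΔ : ∀ x ∈ Metric.ball (0 : 𝔼) R, ‖laplacian u x‖ ≤ M * ‖u x‖) {r : ℝ}
    (hr : 0 < r) (hrR : r ≤ R) {f : 𝔼 → ℂ} (hf : Continuous f) :
    |∫ y, inner ℝ (f y) (laplacian u (r • y)) * ballWeight y ^ 2|
      ≤ M * ∫ y, ‖f y‖ * ‖u (r • y)‖ * ballWeight y ^ 1 := by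
  have cu := hu.continuous
  rw [← integral_const_mul, ← Real.norm_eq_abs]
  refine norm_integral_le_of_norm_le
    ((integrable_mul_ballWeight_pow (by fun_prop) one_ne_zero).const_mul M) (.of_forall fun y => ?_)
  rcases le_or_gt 1 ‖y‖ with hy | hy
  · simp [ballWeight_eq_zero hy]
  · have hmem : r • y ∈ Metric.ball (0 : 𝔼) R := by
      rw [mem_ball_zero_iff, norm_smul, norm_of_nonneg hr.le]
      nlinarith
    rw [norm_mul, norm_of_nonneg (sq_nonneg (ballWeight y)), pow_one]
    calc ‖inner ℝ (f y) (laplacian u (r • y))‖ * ballWeight y ^ 2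
        ≤ (‖f y‖ * (M * ‖u (r • y)‖)) * ballWeight y := by
          refine mul_le_mul ?_ (ballWeight_sq_le y) (sq_nonneg _) (by positivity)
          exact (norm_inner_le_norm _ _).trans (by gcongr; exact hΔ _ hmem)
      _ = M * (‖f y‖ * ‖u (r • y)‖ * ballWeight y) := by ring

theorem sum_integral_inner_fderiv_comp_smul (hu : ContDiff ℝ 2 u) (r : ℝ) {f : 𝔼 → ℂ}
    (hf : ContDiff ℝ 1 f) :
    ∑ i, ∫ y, inner ℝ (fderiv ℝ f y (EuclideanSpace.single i 1))
        (fderiv ℝ (fun y => u (r • y)) y (EuclideanSpace.single i 1)) * ballWeight y ^ 2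
      = 4 * r * (∫ y, inner ℝ (f y) (fderiv ℝ u (r • y) y) * ballWeight y ^ 1)
        - r ^ 2 * ∫ y, inner ℝ (f y) (laplacian u (r • y)) * ballWeight y ^ 2 := by
  have hg : ContDiff ℝ 2 fun y => u (r • y) := hu.comp (contDiff_const_smul r)
  rw [sum_integral_inner_fderiv_mul_ballWeight_sq hf hg]
  simp_rw [laplacian_comp_smul hu, fderiv_comp_smul_apply (hu.differentiable two_ne_zero),
    real_inner_smul_right, mul_assoc, integral_const_mul]

/-- A solution of `|Δu| ≤ M |u|` that is nonzero on a ball has weighted `L²` norms on the smaller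
concentric balls bounded below by a power of the radius. -/
theorem exists_pow_le_integral_norm_sq (hu : ContDiff ℝ 2 u) {R M : ℝ} (hR : 0 < R) (hM : 0 < M)
    (hΔ : ∀ x ∈ Metric.ball (0 : 𝔼) R, ‖laplacian u x‖ ≤ M * ‖u x‖)
    (hpos : 0 < ∫ y, ‖u (R • y)‖ ^ 2 * ballWeight y ^ 1) :
    ∃ k : ℕ, ∃ c : ℝ, 0 < c ∧
      ∀ r, 0 < r → r ≤ R → c * r ^ k ≤ ∫ y, ‖u (r • y)‖ ^ 2 * ballWeight y ^ 1 := by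
  have hu0 := hu.differentiable two_ne_zero
  have cu := hu.continuous
  have cDu : Continuous (fderiv ℝ u) := hu.continuous_fderiv two_ne_zero
  have cDDu : Continuous (fderiv ℝ (fderiv ℝ u)) :=
    (hu.fderiv_right (m := 1) (by norm_num)).continuous_fderiv one_ne_zero
  have cz : ∀ r : ℝ, Continuous fun y : 𝔼 => fderiv ℝ u (r • y) y := fun r =>
    (contDiff_fderiv_smul_apply hu r).continuous
  have cg' : ∀ v : 𝔼, Continuous fun p : ℝ × 𝔼 => fderiv ℝ (fun y => u (p.1 • y)) p.2 v := by
    intro v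
    simp_rw [fderiv_comp_smul_apply hu0]
    fun_prop
  have cz' : ∀ v : 𝔼, Continuous fun p : ℝ × 𝔼 =>
      fderiv ℝ (fun y => fderiv ℝ u (p.1 • y) y) p.2 v := by
    intro v
    simp_rw [fderiv_fderiv_smul_apply hu]
    fun_prop
  refine exists_pow_le_of_frequency hR hM
    (h := fun r => ∫ y, ‖u (r • y)‖ ^ 2 * ballWeight y ^ 1)
    (h' := fun r => ∫ y, (2 * inner ℝ (u (r • y)) (fderiv ℝ u (r • y) y)) * ballWeight y ^ 1)
    (Q := fun r => ∑ i, ∫ y,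
      ‖fderiv ℝ (fun y => u (r • y)) y (EuclideanSpace.single i 1)‖ ^ 2 * ballWeight y ^ 2)
    (Q' := fun r => ∑ i, ∫ y, (2 * inner ℝ
        (fderiv ℝ (fun y => u (r • y)) y (EuclideanSpace.single i 1))
        (fderiv ℝ (fun y => fderiv ℝ u (r • y) y) y (EuclideanSpace.single i 1)))
        * ballWeight y ^ 2)
    (S := fun r => ∫ y, ‖fderiv ℝ u (r • y) y‖ * ‖u (r • y)‖ * ballWeight y ^ 1)
    (fun r => ?_) (fun r => ?_) (fun r => ?_) (fun r => ?_) (fun r hr hrR => ?_)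
    (fun r hr hrR => ?_) (fun r hr hrR => ?_) hpos
  · refine hasDerivAt_integral_mul_ballWeight_pow (F := fun r y => ‖u (r • y)‖ ^ 2)
      (F' := fun r y => 2 * inner ℝ (u (r • y)) (fderiv ℝ u (r • y) y))
      (fun r => by fun_prop) (by fun_prop)
      (fun r y => (hasDerivAt_comp_smul hu0 r y).norm_sq) one_ne_zero r
  · refine HasDerivAt.fun_sum fun i _ => ?_
    have c1 := cg' (EuclideanSpace.single i 1)
    have c2 := cz' (EuclideanSpace.single i 1)
    exact hasDerivAt_integral_mul_ballWeight_pow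
      (F := fun r y => ‖fderiv ℝ (fun y => u (r • y)) y (EuclideanSpace.single i 1)‖ ^ 2)
      (F' := fun r y => 2 * inner ℝ
        (fderiv ℝ (fun y => u (r • y)) y (EuclideanSpace.single i 1))
        (fderiv ℝ (fun y => fderiv ℝ u (r • y) y) y (EuclideanSpace.single i 1)))
      (fun r => ((c1.comp (by fun_prop : Continuous fun y : 𝔼 => (r, y))).norm.pow 2))
      (continuous_const.mul (c1.inner c2))
      (fun r y => (hasDerivAt_fderiv_comp_smul hu r y _).norm_sq) two_ne_zero r
  · exact integral_nonneg fun y => mul_nonneg (by positivity) (pow_nonneg (ballWeight_nonneg y) 1)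
  · exact Finset.sum_nonneg fun i _ => integral_nonneg fun y => by positivity
  · rw [← integral_const_mul, ← Real.norm_eq_abs]
    refine norm_integral_le_of_norm_le
      ((integrable_mul_ballWeight_pow (by fun_prop) one_ne_zero).const_mul 2)
      (.of_forall fun y => ?_)
    rw [norm_mul, norm_mul, norm_of_nonneg (pow_nonneg (ballWeight_nonneg y) 1), ← mul_assoc]
    refine mul_le_mul_of_nonneg_right ?_ (pow_nonneg (ballWeight_nonneg y) 1)
    rw [norm_ofNat, mul_comm ‖fderiv ℝ u (r • y) y‖]
    gcongr
    exact norm_inner_le_norm _ _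
  · have hgreen := sum_integral_inner_fderiv_comp_smul hu r
      (f := fun y => u (r • y)) ((hu.of_le one_le_two).comp (contDiff_const_smul r))
    simp only [real_inner_self_eq_norm_sq] at hgreen
    have hb := abs_integral_inner_laplacian_le hu hM.le hΔ hr hrR
      (f := fun y => u (r • y)) (by fun_prop)
    simp only [← sq] at hb
    simp only [hgreen, mul_assoc 2 (inner ℝ _ _), integral_const_mul]
    rw [show ∀ a b : ℝ, 2 * r * (2 * a) - (4 * r * a - b) = b by intros; ring, abs_mul,
      abs_of_nonneg (sq_nonneg r), mul_assoc]
    gcongr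
  · have hgreen := sum_integral_inner_fderiv_comp_smul hu r (contDiff_fderiv_smul_apply hu r)
    simp only [real_inner_self_eq_norm_sq] at hgreen
    have hb := (abs_le.1 (abs_integral_inner_laplacian_le hu hM.le hΔ hr hrR (cz r))).2
    have hcs := sq_integral_mul_mul_le (μ := (volume : Measure 𝔼))
      (f := fun y => ‖fderiv ℝ u (r • y) y‖) (g := fun y => ‖u (r • y)‖)
      (w := fun y => ballWeight y ^ 1) (fun y => pow_nonneg (ballWeight_nonneg y) 1)
      (integrable_mul_ballWeight_pow (by fun_prop) one_ne_zero)
      (integrable_mul_ballWeight_pow (by fun_prop) one_ne_zero)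
      (integrable_mul_ballWeight_pow (by fun_prop) one_ne_zero)
    have hh : 0 ≤ ∫ y, ‖u (r • y)‖ ^ 2 * ballWeight y ^ 1 :=
      integral_nonneg fun y => mul_nonneg (by positivity) (pow_nonneg (ballWeight_nonneg y) 1)
    have hQ' : ∑ i, ∫ y, (2 * inner ℝ
        (fderiv ℝ (fun y => u (r • y)) y (EuclideanSpace.single i 1))
        (fderiv ℝ (fun y => fderiv ℝ u (r • y) y) y (EuclideanSpace.single i 1)))
        * ballWeight y ^ 2 = 2 * (4 * r * (∫ y, ‖fderiv ℝ u (r • y) y‖ ^ 2 * ballWeight y ^ 1)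
        - r ^ 2 * ∫ y, inner ℝ (fderiv ℝ u (r • y) y) (laplacian u (r • y))
          * ballWeight y ^ 2) := by
      rw [← hgreen, Finset.mul_sum]
      refine Finset.sum_congr rfl fun i _ => ?_
      rw [← integral_const_mul]
      congr 1 with y
      rw [real_inner_comm, mul_assoc]
    simp only [hQ']
    generalize (∫ y, ‖fderiv ℝ u (r • y) y‖ ^ 2 * ballWeight y ^ 1) = P at *
    generalize (∫ y, ‖u (r • y)‖ ^ 2 * ballWeight y ^ 1) = h at *
    generalize (∫ y, ‖fderiv ℝ u (r • y) y‖ * ‖u (r • y)‖ * ballWeight y ^ 1) = S at *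
    generalize (∫ y, inner ℝ (fderiv ℝ u (r • y) y) (laplacian u (r • y)) * ballWeight y ^ 2) = T
      at *
    have h1 : 8 * r * S ^ 2 ≤ 8 * r * (P * h) := by gcongr
    have h2 : 2 * r ^ 2 * h * T ≤ 2 * r ^ 2 * h * (M * S) := by gcongr
    linarith

/-- Strong unique continuation for global `C²` functions satisfying `|Δu| ≤ M |u|` on a ball. -/
theorem eq_zero_of_norm_laplacian_le (hu : ContDiff ℝ 2 u) {R M : ℝ} (hM : 0 < M)
    (hΔ : ∀ x ∈ Metric.ball (0 : 𝔼) R, ‖laplacian u x‖ ≤ M * ‖u x‖)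
    (hvanish : ∀ N : ℕ, 0 < N → ∃ C : ℝ, ∀ x ∈ Metric.ball (0 : 𝔼) R, ‖u x‖ ≤ C * ‖x‖ ^ N) :
    ∀ x ∈ Metric.ball (0 : 𝔼) R, u x = 0 := by
  intro x hx
  by_contra hne
  have hxR : ‖x‖ < R := by simpa using hx
  have hR : 0 < R := (norm_nonneg x).trans_lt hxR
  have cu := hu.continuous
  have hint : ∀ r : ℝ, Integrable fun y : 𝔼 => ‖u (r • y)‖ ^ 2 * ballWeight y ^ 1 := fun r =>
    integrable_mul_ballWeight_pow (by fun_prop) one_ne_zero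
  have hpos : 0 < ∫ y, ‖u (R • y)‖ ^ 2 * ballWeight y ^ 1 := by
    have hcont : Continuous fun y : 𝔼 => ‖u (R • y)‖ ^ 2 * ballWeight y ^ 1 := by
      have := continuous_ballWeight (E := 𝔼)
      fun_prop
    refine integral_pos_of_integrable_nonneg_nonzero (x := R⁻¹ • x) hcont (hint R)
      (fun y => mul_nonneg (by positivity) (pow_nonneg (ballWeight_nonneg y) 1)) ?_
    have hw : 0 < ballWeight (R⁻¹ • x) := by
      refine ballWeight_pos ?_
      rw [norm_smul, norm_inv, norm_of_nonneg hR.le, inv_mul_lt_iff₀ hR]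
      linarith
    rw [smul_inv_smul₀ hR.ne']
    have : 0 < ‖u x‖ := norm_pos_iff.2 hne
    positivity
  obtain ⟨k, c, hc, hk⟩ := exists_pow_le_integral_norm_sq hu hR hM hΔ hpos
  obtain ⟨C, hC⟩ := hvanish (k + 1) k.succ_pos
  set I : ℝ := ∫ y : 𝔼, 1 * ballWeight y ^ 1 with hI
  have upper : ∀ r, 0 < r → r ≤ R →
      ∫ y, ‖u (r • y)‖ ^ 2 * ballWeight y ^ 1 ≤ (C * r ^ (k + 1)) ^ 2 * I := by
    intro r hr hrR
    rw [hI, ← integral_const_mul]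
    refine integral_mono (hint r)
      ((integrable_mul_ballWeight_pow continuous_const one_ne_zero).const_mul _) fun y => ?_
    simp only [pow_one, one_mul]
    rcases le_or_gt 1 ‖y‖ with hy | hy
    · simp [ballWeight_eq_zero hy]
    · have hn : ‖r • y‖ = r * ‖y‖ := by rw [norm_smul, norm_of_nonneg hr.le]
      have hb := hC (r • y) (by rw [mem_ball_zero_iff, hn]; nlinarith)
      refine mul_le_mul_of_nonneg_right ?_ (ballWeight_nonneg y)
      rw [← sq_abs (C * r ^ (k + 1)), abs_mul, abs_of_nonneg (by positivity : 0 ≤ r ^ (k + 1))]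
      gcongr
      refine hb.trans ?_
      rw [hn]
      gcongr
      · exact le_abs_self C
      · nlinarith
  have lim : Filter.Tendsto (fun r : ℝ => C ^ 2 * I * r ^ (k + 2)) (nhdsWithin 0 (Set.Ioi 0))
      (nhds 0) := by
    have : Continuous fun r : ℝ => C ^ 2 * I * r ^ (k + 2) := by fun_prop
    simpa using (this.tendsto 0).mono_left nhdsWithin_le_nhds
  have hle : c ≤ 0 := by
    refine ge_of_tendsto lim ?_
    filter_upwards [Ioc_mem_nhdsGT hR] with r hr
    have h1 := (hk r hr.1 hr.2).trans (upper r hr.1 hr.2)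
    have h2 : (C * r ^ (k + 1)) ^ 2 * I = (C ^ 2 * I * r ^ (k + 2)) * r ^ k := by ring
    rw [h2] at h1
    exact le_of_mul_le_mul_right h1 (pow_pos hr.1 k)
  linarith

end Dilation

theorem laplacian_congr_of_eventuallyEq {n : ℕ} {u v : EuclideanSpace ℝ (Fin n) → ℂ}
    {x : EuclideanSpace ℝ (Fin n)} (h : u =ᶠ[nhds x] v) : laplacian u x = laplacian v x := by
  refine Finset.sum_congr rfl fun i _ => ?_
  have h1 : (fun y => fderiv ℝ u y (EuclideanSpace.single i 1)) =ᶠ[nhds x]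
      fun y => fderiv ℝ v y (EuclideanSpace.single i 1) := by
    filter_upwards [h.fderiv (𝕜 := ℝ)] with y hy
    rw [hy]
  rw [h1.fderiv_eq]

/-- A `C²` function on a ball agrees on any smaller concentric ball with a global `C²` function. -/
theorem exists_contDiff_eqOn_ball {n : ℕ} {u : EuclideanSpace ℝ (Fin n) → ℂ} {R R' : ℝ}
    (hR : 0 < R) (hRR' : R < R') (hu : ContDiffOn ℝ 2 u (Metric.ball 0 R')) :
    ∃ v : EuclideanSpace ℝ (Fin n) → ℂ, ContDiff ℝ 2 v ∧ Set.EqOn v u (Metric.ball 0 R) := by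
  obtain ⟨ρ, hRρ, hρR'⟩ := exists_between hRR'
  let χ : ContDiffBump (0 : EuclideanSpace ℝ (Fin n)) := ⟨R, ρ, hR, hRρ⟩
  refine ⟨fun x => χ x • u x, contDiff_iff_contDiffAt.2 fun x => ?_, fun x hx => ?_⟩
  · by_cases hx : x ∈ Metric.ball (0 : EuclideanSpace ℝ (Fin n)) R'
    · exact χ.contDiffAt.smul (hu.contDiffAt (Metric.isOpen_ball.mem_nhds hx))
    · have hx' : x ∈ (Metric.closedBall (0 : EuclideanSpace ℝ (Fin n)) ρ)ᶜ := fun h =>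
        hx (Metric.closedBall_subset_ball hρR' h)
      refine (contDiffAt_const (c := (0 : ℂ))).congr_of_eventuallyEq ?_
      filter_upwards [Metric.isClosed_closedBall.isOpen_compl.mem_nhds hx'] with y hy
      have : χ y = 0 := χ.zero_of_le_dist 
        (not_le.1 (mt Metric.mem_closedBall.2 hy)).le
      simp [this]
  · have : χ x = 1 := χ.one_of_mem_closedBall (Metric.ball_subset_closedBall hx)
    simp [this]

/-- **Carleman's strong unique continuation theorem** (Carleman, 1939). If `Δu = q u` in
`B(0,10)` with `‖u‖_{L^∞} ≤ C₀`, `‖q‖_{L^∞} ≤ M`, and `u` vanishes to infinite order at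
the origin (`|u(x)| ≤ C_N |x|^N` for each `N > 0`), then `u ≡ 0` in `B(0,10)`. -/
theorem carleman_strong_unique_continuation (n : ℕ) (hn : 1 ≤ n) (C₀ M : ℝ)
    (hC₀ : 0 < C₀) (hM : 0 < M)
    (u q : EuclideanSpace ℝ (Fin n) → ℂ)
    (hu2 : ContDiffOn ℝ 2 u (Metric.ball 0 10))
    (heq : ∀ x ∈ Metric.ball (0 : EuclideanSpace ℝ (Fin n)) 10, laplacian u x = q x * u x)
    (hub : ∀ x ∈ Metric.ball (0 : EuclideanSpace ℝ (Fin n)) 10, ‖u x‖ ≤ C₀)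
    (hqb : ∀ x ∈ Metric.ball (0 : EuclideanSpace ℝ (Fin n)) 10, ‖q x‖ ≤ M)
    (hvanish : ∀ N : ℝ, 0 < N → ∃ C : ℝ,
      ∀ x ∈ Metric.ball (0 : EuclideanSpace ℝ (Fin n)) 10, ‖u x‖ ≤ C * ‖x‖ ^ N) :
    ∀ x ∈ Metric.ball (0 : EuclideanSpace ℝ (Fin n)) 10, u x = 0 := by
  intro x hx
  obtain ⟨R, hxR, hR⟩ := exists_between (mem_ball_zero_iff.1 hx)
  have hR0 : 0 < R := (norm_nonneg x).trans_lt hxR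
  obtain ⟨v, hv, hvu⟩ := exists_contDiff_eqOn_ball hR0 hR hu2
  have hsub : Metric.ball (0 : EuclideanSpace ℝ (Fin n)) R ⊆ Metric.ball 0 10 :=
    Metric.ball_subset_ball hR.le
  have hxR' := mem_ball_zero_iff.2 hxR
  rw [← hvu hxR']
  refine eq_zero_of_norm_laplacian_le hv hM (fun y hy => ?_) (fun N hN => ?_) x hxR'
  · rw [laplacian_congr_of_eventuallyEq (hvu.eventuallyEq_of_mem (Metric.isOpen_ball.mem_nhds hy)),
      heq y (hsub hy), hvu hy, norm_mul]
    gcongr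
    exact hqb y (hsub hy)
  · obtain ⟨C, hC⟩ := hvanish N (by exact_mod_cast hN)
    refine ⟨C, fun y hy => ?_⟩
    rw [hvu hy, ← Real.rpow_natCast]
    exact hC y (hsub hy)
end

section
/- There are constants α > 1 > ε > 0 with the following property. Let u : ℤ² → ℝ be lattice harmonic in a square Q ⊆ ℤ² of side length L ≥ α, meaning that Δ_d u(x) = 0 for every x ∈ Q, where Δ_d u(x) = ∑_{|y−x|=1} (u(y) − u(x)) is the discrete Laplacian on ℤ². Then the number of points x ∈ Q with |u(x)| ≥ e^{−αL} ‖u‖_{ℓ^∞(½Q)} is at least εL², where ½Q denotes the concentric subsquare of Q of half the side length. -/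
open Real

/-- The discrete Laplacian on `ℤ²`: `Δ_d u(x) = ∑_{|y−x|=1} (u(y) − u(x))`. -/
def discreteLaplacian (u : ℤ × ℤ → ℝ) (x : ℤ × ℤ) : ℝ :=
  u (x.1 + 1, x.2) + u (x.1 - 1, x.2) + u (x.1, x.2 + 1) + u (x.1, x.2 - 1) - 4 * u x

/-- The square in `ℤ²` with lower-left corner `(a, b)` and side length `L`. -/
def latticeSquare (a b : ℤ) (L : ℕ) : Set (ℤ × ℤ) :=
  {x | a ≤ x.1 ∧ x.1 < a + L ∧ b ≤ x.2 ∧ x.2 < b + L}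

/-- The concentric subsquare of half the side length (`½Q`). -/
def latticeHalfSquare (a b : ℤ) (L : ℕ) : Set (ℤ × ℤ) :=
  {x | (a : ℝ) + L / 4 ≤ (x.1 : ℝ) ∧ (x.1 : ℝ) < (a : ℝ) + 3 * L / 4 ∧
       (b : ℝ) + L / 4 ≤ (x.2 : ℝ) ∧ (x.2 : ℝ) < (b : ℝ) + 3 * L / 4}

/-- A finite family of distinct positive integers has product at least the factorial of its
cardinality. -/
theorem factorial_card_le_prod {ι : Type*} (s : Finset ι) (g : ι → ℕ) (hg : Set.InjOn g s)
    (hpos : ∀ j ∈ s, 0 < g j) : (s.card).factorial ≤ ∏ j ∈ s, g j := by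
  classical
  have key : ∀ t : Finset ℕ, (∀ n ∈ t, 0 < n) → (t.card).factorial ≤ ∏ n ∈ t, n := by
    intro t
    induction t using Finset.induction_on_max with
    | empty => simp
    | insert a t hlt ih =>
      intro ht
      have hat : a ∉ t := fun h => lt_irrefl _ (hlt a h)
      rw [Finset.card_insert_of_notMem hat, Finset.prod_insert hat, Nat.factorial_succ]
      refine Nat.mul_le_mul ?_ (ih fun n hn => ht n (Finset.mem_insert_of_mem hn))
      have hsub : insert a t ⊆ Finset.Icc 1 a := by
        intro n hn
        rw [Finset.mem_Icc]
        refine ⟨ht n hn, ?_⟩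
        rcases Finset.mem_insert.1 hn with rfl | h
        · exact le_rfl
        · exact (hlt n h).le
      have := Finset.card_le_card hsub
      rwa [Finset.card_insert_of_notMem hat, Nat.card_Icc, Nat.add_sub_cancel] at this
  have := key (s.image g) (by simpa using hpos)
  rwa [Finset.card_image_of_injOn hg, Finset.prod_image hg] at this

/-- Lower bound for the product of the distances from a node to the other nodes. -/
theorem factorial_le_two_pow_mul_prod_abs_sub (s : Finset ℕ) {i : ℕ} (hi : i ∈ s) :
    ((s.card - 1).factorial : ℝ) ≤
      2 ^ (s.card - 1) * ∏ j ∈ s.erase i, |(i : ℝ) - j| := by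
  classical
  set l := (s.erase i).filter (· < i) with hl
  set r := (s.erase i).filter (fun j => ¬ j < i) with hr
  have hcard : l.card + r.card = s.card - 1 := by
    rw [hl, hr, Finset.card_filter_add_card_filter_not, Finset.card_erase_of_mem hi]
  have hL : ((l.card).factorial : ℝ) ≤ ∏ j ∈ l, |(i : ℝ) - j| := by
    have h := factorial_card_le_prod l (fun j => i - j)
      (by intro a ha b hb; simp [hl] at ha hb; simp only; omega)
      (by intro j hj; simp [hl] at hj; omega)
    calc ((l.card).factorial : ℝ) ≤ ((∏ j ∈ l, (i - j) : ℕ) : ℝ) := by exact_mod_cast h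
      _ = ∏ j ∈ l, |(i : ℝ) - j| := by
        rw [Nat.cast_prod]
        refine Finset.prod_congr rfl fun j hj => ?_
        have hj' : j ≤ i := by simp [hl] at hj; omega
        rw [Nat.cast_sub hj', abs_of_nonneg (sub_nonneg.2 (by exact_mod_cast hj'))]
  have hR : ((r.card).factorial : ℝ) ≤ ∏ j ∈ r, |(i : ℝ) - j| := by
    have h := factorial_card_le_prod r (fun j => j - i)
      (by intro a ha b hb; simp [hr] at ha hb; simp only; omega)
      (by intro j hj; simp [hr] at hj; omega)
    calc ((r.card).factorial : ℝ) ≤ ((∏ j ∈ r, (j - i) : ℕ) : ℝ) := by exact_mod_cast h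
      _ = ∏ j ∈ r, |(i : ℝ) - j| := by
        rw [Nat.cast_prod]
        refine Finset.prod_congr rfl fun j hj => ?_
        have hj' : i ≤ j := by simp [hr] at hj; omega
        rw [Nat.cast_sub hj', abs_sub_comm,
          abs_of_nonneg (sub_nonneg.2 (by exact_mod_cast hj'))]
  have hprod : ∏ j ∈ s.erase i, |(i : ℝ) - j| =
      (∏ j ∈ l, |(i : ℝ) - j|) * ∏ j ∈ r, |(i : ℝ) - j| :=
    (Finset.prod_filter_mul_prod_filter_not _ _ _).symm
  have hchoose : ((s.card - 1).factorial : ℝ) ≤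
      2 ^ (s.card - 1) * (((l.card).factorial : ℝ) * (r.card).factorial) := by
    rw [← hcard]
    have h1 := Nat.add_choose_mul_factorial_mul_factorial l.card r.card
    have h2 := Nat.choose_le_two_pow (l.card + r.card) r.card
    have h3 : (l.card + r.card).factorial ≤
        2 ^ (l.card + r.card) * ((l.card).factorial * (r.card).factorial) := by
      rw [← h1, mul_assoc]
      exact Nat.mul_le_mul_right _ h2
    exact_mod_cast h3
  rw [hprod]
  refine hchoose.trans ?_
  gcongr

open Polynomial in
/-- A polynomial of degree less than `T` which is bounded by `B` at `T` integers of `[0, n]` is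
bounded by `4 ^ T * exp n * B` on `[0, n]`. -/
theorem abs_eval_le_of_abs_eval_nodes_le (P : ℝ[X]) (s : Finset ℕ) (n : ℕ) (B : ℝ)
    (hs : ∀ j ∈ s, j ≤ n) (hne : s.Nonempty)
    (hdeg : P.degree < s.card) (hB : ∀ j ∈ s, |P.eval (j : ℝ)| ≤ B)
    {x : ℝ} (hx0 : 0 ≤ x) (hxn : x ≤ n) :
    |P.eval x| ≤ 4 ^ s.card * exp n * B := by
  classical
  have hinj : Set.InjOn (fun j : ℕ => (j : ℝ)) s := Nat.cast_injective.injOn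
  have hP := Lagrange.eq_interpolate (v := fun j : ℕ => (j : ℝ)) hinj hdeg
  have hbasis : ∀ i ∈ s, |(Lagrange.basis s (fun j : ℕ => (j : ℝ)) i).eval x| ≤
      2 ^ s.card * exp n := by
    intro i hi
    have hne : ∀ j ∈ s.erase i, 0 < |(i : ℝ) - j| := fun j hj => by
      rw [abs_pos, sub_ne_zero]
      exact_mod_cast (Finset.ne_of_mem_erase hj).symm
    have hden : 0 < ∏ j ∈ s.erase i, |(i : ℝ) - j| := Finset.prod_pos hne
    have heval : |(Lagrange.basis s (fun j : ℕ => (j : ℝ)) i).eval x| =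
        (∏ j ∈ s.erase i, |x - j|) / ∏ j ∈ s.erase i, |(i : ℝ) - j| := by
      rw [Lagrange.basis, eval_prod, Finset.abs_prod, ← Finset.prod_div_distrib]
      refine Finset.prod_congr rfl fun j hj => ?_
      simp [Lagrange.basisDivisor, abs_mul, abs_inv, div_eq_inv_mul]
    have hnum : ∏ j ∈ s.erase i, |x - j| ≤ (n : ℝ) ^ (s.card - 1) := by
      rw [← Finset.card_erase_of_mem hi]
      refine (Finset.prod_le_prod (fun _ _ => abs_nonneg _) fun j hj => ?_).trans_eq
        (Finset.prod_const _)
      have h1 : (j : ℝ) ≤ n := by exact_mod_cast hs j (Finset.mem_of_mem_erase hj)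
      have h2 : (0 : ℝ) ≤ j := by positivity
      rw [abs_le]; constructor <;> linarith
    have hfact := factorial_le_two_pow_mul_prod_abs_sub s hi
    have hexp := Real.pow_div_factorial_le_exp (x := (n : ℝ)) (by positivity) (s.card - 1)
    have hf : (0 : ℝ) < (s.card - 1).factorial := by exact_mod_cast Nat.factorial_pos _
    rw [heval, div_le_iff₀ hden]
    rw [div_le_iff₀ hf] at hexp
    calc _ ≤ exp n * (s.card - 1).factorial := hnum.trans hexp
      _ ≤ exp n * (2 ^ (s.card - 1) * ∏ j ∈ s.erase i, |(i : ℝ) - j|) := by gcongr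
      _ ≤ exp n * (2 ^ s.card * ∏ j ∈ s.erase i, |(i : ℝ) - j|) := by
        gcongr
        · norm_num
        · omega
      _ = _ := by ring
  have hle : |P.eval x| ≤ ∑ i ∈ s, B * (2 ^ s.card * exp n) := by
    rw [hP, Lagrange.interpolate_apply, eval_finsetSum]
    refine (Finset.abs_sum_le_sum_abs _ _).trans (Finset.sum_le_sum fun i hi => ?_)
    rw [eval_mul, eval_C, abs_mul]
    exact mul_le_mul (hB i hi) (hbasis i hi) (abs_nonneg _) ((abs_nonneg _).trans (hB i hi))
  obtain ⟨i, hi⟩ := hne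
  have hB0 : 0 ≤ B := (abs_nonneg _).trans (hB i hi)
  rw [Finset.sum_const, nsmul_eq_mul] at hle
  have h2 : (s.card : ℝ) ≤ 2 ^ s.card := by exact_mod_cast (Nat.lt_two_pow_self).le
  calc |P.eval x| ≤ s.card * (B * (2 ^ s.card * exp n)) := hle
    _ ≤ 2 ^ s.card * (B * (2 ^ s.card * exp n)) := by gcongr
    _ = _ := by
      rw [show (4 : ℝ) = 2 * 2 by norm_num, mul_pow]; ring

/-- A function on `ℤ` whose `T`-th difference vanishes agrees with a polynomial of degree less
than `T` to the right of any point. -/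
theorem exists_polynomial_of_fwdDiff_iter_eq_zero {f : ℤ → ℝ} {T : ℕ}
    (hf : (fwdDiff 1)^[T] f = 0) (a : ℤ) :
    ∃ P : Polynomial ℝ, P.degree < T ∧ ∀ j : ℕ, P.eval (j : ℝ) = f (a + j) := by
  refine ⟨∑ k ∈ Finset.range T, ((fwdDiff 1)^[k] f a / k.factorial) •
    descPochhammer ℝ k, ?_, fun j => ?_⟩
  · refine (Polynomial.degree_sum_le _ _).trans_lt ?_
    rw [Finset.sup_lt_iff (WithBot.bot_lt_coe _)]
    intro k hk
    refine (Polynomial.degree_smul_le _ _).trans_lt ?_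
    rw [Polynomial.degree_eq_natDegree (monic_descPochhammer ℝ k).ne_zero,
      descPochhammer_natDegree]
    exact_mod_cast Finset.mem_range.1 hk
  · have hzero : ∀ k, T ≤ k → (fwdDiff 1)^[k] f a = 0 := by
      intro k hk
      obtain ⟨m, rfl⟩ := Nat.exists_eq_add_of_le hk
      rw [add_comm, Function.iterate_add_apply, hf]
      simp [fwdDiff_iter_eq_sum_shift]
    have hN := shift_eq_sum_fwdDiff_iter (1 : ℤ) f j a
    rw [nsmul_one] at hN
    rw [hN, Polynomial.eval_finsetSum]
    have hterm : ∀ k, Polynomial.eval (j : ℝ)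
        (((fwdDiff 1)^[k] f a / k.factorial) • descPochhammer ℝ k) =
        j.choose k • (fwdDiff 1)^[k] f a := by
      intro k
      rw [Polynomial.eval_smul, smul_eq_mul, descPochhammer_eval_eq_descFactorial,
        Nat.descFactorial_eq_factorial_mul_choose, nsmul_eq_mul]
      have : (k.factorial : ℝ) ≠ 0 := by exact_mod_cast Nat.factorial_ne_zero k
      push_cast
      field_simp
    simp_rw [hterm]
    rcases le_total T (j + 1) with h | h
    · refine Finset.sum_subset (Finset.range_subset_range.2 h) fun k _ hk => ?_
      rw [hzero k (by simpa using hk), smul_zero]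
    · refine (Finset.sum_subset (Finset.range_subset_range.2 h) fun k _ hk => ?_).symm
      rw [Nat.choose_eq_zero_of_lt (by simp at hk; omega), zero_smul]

/-- Discrete Remez-type inequality on an integer interval of `n + 1` points. -/
theorem abs_le_of_fwdDiff_iter_eq_zero {f : ℤ → ℝ} {T : ℕ} (hT : 0 < T)
    (hf : (fwdDiff 1)^[T] f = 0) (a : ℤ) (n : ℕ) (B : ℝ) (G : Finset ℤ) (hG : T ≤ G.card)
    (hGa : ∀ i ∈ G, a ≤ i ∧ i ≤ a + n) (hB : ∀ i ∈ G, |f i| ≤ B)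
    {i : ℤ} (hai : a ≤ i) (hin : i ≤ a + n) :
    |f i| ≤ 4 ^ T * exp n * B := by
  classical
  obtain ⟨P, hdeg, hP⟩ := exists_polynomial_of_fwdDiff_iter_eq_zero hf a
  obtain ⟨G', hG', hcard⟩ := Finset.exists_subset_card_eq hG
  have hinj : Set.InjOn (fun i : ℤ => (i - a).toNat) G' := by
    intro x hx y hy h
    have := hGa x (hG' hx)
    have := hGa y (hG' hy)
    simp only at h
    omega
  have hc : (G'.image fun i : ℤ => (i - a).toNat).card = T := by
    rw [Finset.card_image_of_injOn hinj, hcard]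
  obtain ⟨k, rfl⟩ : ∃ k : ℕ, i = a + k := ⟨(i - a).toNat, by omega⟩
  have := abs_eval_le_of_abs_eval_nodes_le P (G'.image fun i : ℤ => (i - a).toNat) n B
    (by
      intro j hj
      obtain ⟨x, hx, rfl⟩ := Finset.mem_image.1 hj
      have := hGa x (hG' hx)
      omega)
    (by rw [← Finset.card_pos, hc]; exact hT) (by rwa [hc])
    (by
      intro j hj
      obtain ⟨x, hx, rfl⟩ := Finset.mem_image.1 hj
      have h := hGa x (hG' hx)
      rw [hP, show a + ((x - a).toNat : ℤ) = x by omega]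
      exact hB x (hG' hx))
    (x := k) (by positivity) (by exact_mod_cast (show k ≤ n by omega))
  rwa [hP, hc] at this

/-- Weighted size of the Newton coefficients of `f` at `i`. -/
noncomputable def diffNorm (K : ℕ) (f : ℤ → ℝ) (i : ℤ) : ℝ :=
  ∑ m ∈ Finset.range K, 4 ^ m * |(fwdDiff 1)^[m] f i|

theorem diffNorm_nonneg (K : ℕ) (f : ℤ → ℝ) (i : ℤ) : 0 ≤ diffNorm K f i :=
  Finset.sum_nonneg fun _ _ => by positivity

theorem abs_le_diffNorm {K : ℕ} (hK : 0 < K) (f : ℤ → ℝ) (i : ℤ) : |f i| ≤ diffNorm K f i := by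
  have := Finset.single_le_sum (f := fun m => (4 : ℝ) ^ m * |(fwdDiff 1)^[m] f i|)
    (fun _ _ => by positivity) (Finset.mem_range.2 hK)
  simpa [diffNorm] using this

theorem diffNorm_add_le (K : ℕ) (f g : ℤ → ℝ) (i : ℤ) :
    diffNorm K (f + g) i ≤ diffNorm K f i + diffNorm K g i := by
  unfold diffNorm
  rw [← Finset.sum_add_distrib]
  refine Finset.sum_le_sum fun m _ => ?_
  rw [fwdDiff_iter_add, Pi.add_apply, ← mul_add]
  gcongr
  exact abs_add_le _ _

theorem diffNorm_const_smul (K : ℕ) (c : ℝ) (f : ℤ → ℝ) (i : ℤ) :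
    diffNorm K (c • f) i = |c| * diffNorm K f i := by
  unfold diffNorm
  rw [Finset.mul_sum]
  refine Finset.sum_congr rfl fun m _ => ?_
  rw [fwdDiff_iter_const_smul, Pi.smul_apply, smul_eq_mul, abs_mul]
  ring

theorem diffNorm_comp_add (K : ℕ) (f : ℤ → ℝ) (a i : ℤ) :
    diffNorm K (fun j => f (j + a)) i = diffNorm K f (i + a) := by
  simp only [diffNorm, fwdDiff_iter_comp_add]

theorem four_mul_diffNorm_fwdDiff_le {K : ℕ} {f : ℤ → ℝ} (hf : (fwdDiff 1)^[K] f = 0) (i : ℤ) :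
    4 * diffNorm K (fwdDiff 1 f) i ≤ diffNorm K f i := by
  have h1 := Finset.sum_range_succ (fun m => (4 : ℝ) ^ m * |(fwdDiff 1)^[m] f i|) K
  rw [Finset.sum_range_succ', hf] at h1
  simp only [Pi.zero_apply, abs_zero, mul_zero, add_zero, pow_zero, one_mul] at h1
  unfold diffNorm
  rw [← h1, Finset.mul_sum]
  have h2 : ∑ m ∈ Finset.range K, 4 * ((4 : ℝ) ^ m * |(fwdDiff 1)^[m] (fwdDiff 1 f) i|) =
      ∑ m ∈ Finset.range K, (4 : ℝ) ^ (m + 1) * |(fwdDiff 1)^[m + 1] f i| :=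
    Finset.sum_congr rfl fun m _ => by rw [Function.iterate_succ_apply, pow_succ]; ring
  rw [h2]
  have := abs_nonneg ((fwdDiff 1)^[0] f i)
  linarith

theorem diffNorm_add_one_le {K : ℕ} {f : ℤ → ℝ} (hf : (fwdDiff 1)^[K] f = 0) (i : ℤ) :
    4 * diffNorm K f (i + 1) ≤ 5 * diffNorm K f i := by
  have h : (fun j => f (j + 1)) = f + fwdDiff 1 f := by
    ext j; simp [fwdDiff]
  have h1 := diffNorm_add_le K f (fwdDiff 1 f) i
  have h2 := four_mul_diffNorm_fwdDiff_le hf i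
  rw [← h, diffNorm_comp_add] at h1
  linarith

theorem diffNorm_le_add_one {K : ℕ} {f : ℤ → ℝ} (hf : (fwdDiff 1)^[K] f = 0) (i : ℤ) :
    3 * diffNorm K f i ≤ 4 * diffNorm K f (i + 1) := by
  have h : f = (fun j => f (j + 1)) + (-1 : ℝ) • fwdDiff 1 f := by
    ext j; simp [fwdDiff]
  have h1 := diffNorm_add_le K (fun j => f (j + 1)) ((-1 : ℝ) • fwdDiff 1 f) i
  have h2 := four_mul_diffNorm_fwdDiff_le hf i
  rw [← h, diffNorm_comp_add, diffNorm_const_smul, abs_neg, abs_one, one_mul] at h1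
  linarith

theorem diffNorm_le_two_pow_mul {K : ℕ} {f : ℤ → ℝ} (hf : (fwdDiff 1)^[K] f = 0) (k : ℕ) (i j : ℤ)
    (h : |i - j| ≤ k) : diffNorm K f i ≤ 2 ^ k * diffNorm K f j := by
  induction k generalizing i with
  | zero =>
    obtain rfl : i = j := by
      have := abs_nonneg (i - j)
      have h0 : |i - j| = 0 := by push_cast at h; omega
      rw [abs_eq_zero] at h0; omega
    simp
  | succ k ih =>
    have h0 := diffNorm_nonneg K f j
    have hk : (1 : ℝ) ≤ 2 ^ k := one_le_pow₀ (by norm_num)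
    rw [abs_le] at h
    push_cast at h
    rw [pow_succ]
    rcases lt_trichotomy i j with hij | rfl | hij
    · have h1 := ih (i + 1) (by rw [abs_le]; omega)
      have h2 := diffNorm_le_add_one hf i
      have h3 := diffNorm_nonneg K f (i + 1)
      linarith
    · nlinarith
    · have h1 := ih (i - 1) (by rw [abs_le]; omega)
      have h2 := diffNorm_add_one_le hf (i - 1)
      have h3 := diffNorm_nonneg K f (i - 1)
      rw [sub_add_cancel] at h2
      linarith

theorem abs_fwdDiff_iter_le {f : ℤ → ℝ} {a : ℤ} {n : ℕ} {B : ℝ}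
    (hB : ∀ i, a ≤ i → i ≤ a + n → |f i| ≤ B) (m : ℕ) :
    ∀ i, a ≤ i → i + m ≤ a + n → |(fwdDiff 1)^[m] f i| ≤ 2 ^ m * B := by
  induction m with
  | zero => intro i h1 h2; simpa using hB i h1 (by simpa using h2)
  | succ m ih =>
    intro i h1 h2
    push_cast at h2
    rw [Function.iterate_succ_apply', fwdDiff]
    have e1 := ih (i + 1) (by omega) (by omega)
    have e2 := ih i h1 (by omega)
    have := abs_sub ((fwdDiff 1)^[m] f (i + 1)) ((fwdDiff 1)^[m] f i)
    rw [pow_succ]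
    linarith

theorem diffNorm_le_of_abs_le {f : ℤ → ℝ} {a : ℤ} {n K : ℕ} {B : ℝ} (hK : K ≤ n + 1) (hB0 : 0 ≤ B)
    (hB : ∀ i, a ≤ i → i ≤ a + n → |f i| ≤ B) : diffNorm K f a ≤ 8 ^ K * B := by
  have h : diffNorm K f a ≤ ∑ m ∈ Finset.range K, (8 : ℝ) ^ m * B := by
    refine Finset.sum_le_sum fun m hm => ?_
    have hm' := Finset.mem_range.1 hm
    have := abs_fwdDiff_iter_le hB m a le_rfl (by omega)
    calc (4 : ℝ) ^ m * |(fwdDiff 1)^[m] f a| ≤ 4 ^ m * (2 ^ m * B) := by gcongr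
      _ = 8 ^ m * B := by rw [← mul_assoc, ← mul_pow]; norm_num
  refine h.trans ?_
  rw [← Finset.sum_mul]
  gcongr
  rw [geom_sum_eq (by norm_num)]
  rw [div_le_iff₀ (by norm_num)]
  have : (0 : ℝ) < 8 ^ K := by positivity
  linarith

/-- The lattice harmonicity equation, written along consecutive diagonals with alternating signs. -/
def DiagonalRecurrence (W : ℕ → ℤ → ℝ) : Prop :=
  ∀ t i, W (t + 2) (i + 1) - W (t + 2) i = -4 * W (t + 1) i + W t i - W t (i - 1)

namespace DiagonalRecurrence

variable {W : ℕ → ℤ → ℝ}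

theorem fwdDiff_eq (hW : DiagonalRecurrence W) (t : ℕ) :
    fwdDiff 1 (W (t + 2)) =
      (-4 : ℝ) • W (t + 1) + fun i => fwdDiff 1 (W t) (i + -1) := by
  ext i
  have := hW t i
  simp only [fwdDiff, Pi.add_apply, Pi.smul_apply, smul_eq_mul, neg_add_cancel_right]
  rw [← sub_eq_add_neg i 1]
  linarith

/-- With vanishing initial data, the values on the `t`-th diagonal form a polynomial of degree less
than `t`. -/
theorem fwdDiff_iter_eq_zero (hW : DiagonalRecurrence W) (h0 : W 0 = 0) (h1 : W 1 = 0) (t m : ℕ)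
    (htm : t ≤ m) : (fwdDiff 1)^[m] (W t) = 0 := by
  have hz : ∀ m, (fwdDiff (1 : ℤ))^[m] (0 : ℤ → ℝ) = 0 := fun m => by
    ext; simp [fwdDiff_iter_eq_sum_shift]
  induction t using Nat.strong_induction_on generalizing m with
  | _ t ih =>
    match t, m with
    | 0, _ => rw [h0, hz]
    | 1, _ => rw [h1, hz]
    | t + 2, 0 => omega
    | t + 2, m + 1 =>
      rw [Function.iterate_succ_apply, hW.fwdDiff_eq, fwdDiff_iter_add, fwdDiff_iter_const_smul,
        ih (t + 1) (by omega) m (by omega)]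
      ext i
      rw [Pi.add_apply, fwdDiff_iter_comp_add, ← Function.iterate_succ_apply,
        ih t (by omega) (m + 1) (by omega)]
      simp

/-- With vanishing initial data, the Newton coefficients grow along the diagonals. -/
theorem diffNorm_le_succ (hW : DiagonalRecurrence W) (h0 : W 0 = 0) (h1 : W 1 = 0) {T : ℕ} (i : ℤ)
    (t : ℕ) (ht : t + 1 ≤ T) : diffNorm T (W t) i ≤ diffNorm T (W (t + 1)) i := by
  have hz : diffNorm T (0 : ℤ → ℝ) i = 0 := by
    simpa using diffNorm_const_smul T 0 0 i
  induction t with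
  | zero => rw [h0, hz]; exact diffNorm_nonneg _ _ _
  | succ t ih =>
    have hprev := ih (by omega)
    have hT : ∀ s ≤ T, (fwdDiff 1)^[T] (W s) = 0 := fun s hs =>
      hW.fwdDiff_iter_eq_zero h0 h1 s T hs
    have heq : (4 : ℝ) • W (t + 1) =
        (-1 : ℝ) • fwdDiff 1 (W (t + 2)) + fun j => fwdDiff 1 (W t) (j + -1) := by
      rw [hW.fwdDiff_eq t]
      ext j
      simp
    have hle := diffNorm_add_le T ((-1 : ℝ) • fwdDiff 1 (W (t + 2)))
      (fun j => fwdDiff 1 (W t) (j + -1)) i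
    rw [← heq, diffNorm_const_smul, diffNorm_const_smul, diffNorm_comp_add] at hle
    norm_num at hle
    have e1 := four_mul_diffNorm_fwdDiff_le (hT (t + 2) ht) i
    have e2 := four_mul_diffNorm_fwdDiff_le (hT t (by omega)) (i + -1)
    have e3 := diffNorm_le_add_one (hT t (by omega)) (i + -1)
    rw [neg_add_cancel_right] at e3
    have e4 := diffNorm_nonneg T (W (t + 2)) i
    linarith

theorem diffNorm_le (hW : DiagonalRecurrence W) (h0 : W 0 = 0) (h1 : W 1 = 0) {T : ℕ} (i : ℤ)
    (t : ℕ) (ht : t ≤ T) : diffNorm T (W t) i ≤ diffNorm T (W T) i := by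
  suffices h : ∀ s, t ≤ s → s ≤ T → diffNorm T (W t) i ≤ diffNorm T (W s) i from h T ht le_rfl
  intro s hs
  induction s, hs using Nat.le_induction with
  | base => exact fun _ => le_rfl
  | succ s hs ih => exact fun h => (ih (by omega)).trans (hW.diffNorm_le_succ h0 h1 i s h)

/-- A solution with vanishing initial data which is bounded at `T` points of the `T`-th diagonal is
bounded, with exponential loss, on all previous diagonals. -/
theorem abs_le (hW : DiagonalRecurrence W) (h0 : W 0 = 0) (h1 : W 1 = 0) {T : ℕ} (hT : 0 < T)
    (a : ℤ) (n : ℕ) (B : ℝ) (G : Finset ℤ) (hG : T ≤ G.card)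
    (hGa : ∀ i ∈ G, a ≤ i ∧ i ≤ a + n) (hB : ∀ i ∈ G, |W T i| ≤ B)
    {t k : ℕ} (ht : t ≤ T) {i : ℤ} (hi : |i - a| ≤ k) :
    |W t i| ≤ 2 ^ k * (32 ^ T * exp n * B) := by
  have hdiff : ∀ s ≤ T, (fwdDiff 1)^[T] (W s) = 0 := fun s hs =>
    hW.fwdDiff_iter_eq_zero h0 h1 s T hs
  have hB0 : 0 ≤ B := by
    obtain ⟨j, hj⟩ := Finset.card_pos.1 (hT.trans_le hG)
    exact (abs_nonneg _).trans (hB j hj)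
  have hTn : T ≤ n + 1 := by
    have : G ⊆ Finset.Icc a (a + n) := fun j hj => Finset.mem_Icc.2 (hGa j hj)
    have := Finset.card_le_card this
    rw [Int.card_Icc] at this
    omega
  have hline : ∀ j, a ≤ j → j ≤ a + n → |W T j| ≤ 4 ^ T * exp n * B := fun j hj hjn =>
    abs_le_of_fwdDiff_iter_eq_zero hT (hdiff T le_rfl) a n B G hG hGa hB hj hjn
  have hnorm := diffNorm_le_of_abs_le hTn (by positivity) hline
  calc |W t i| ≤ diffNorm T (W t) i := abs_le_diffNorm hT _ _
    _ ≤ 2 ^ k * diffNorm T (W t) a := diffNorm_le_two_pow_mul (hdiff t ht) k i a hi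
    _ ≤ 2 ^ k * diffNorm T (W T) a := by gcongr; exact hW.diffNorm_le h0 h1 a t ht
    _ ≤ 2 ^ k * (8 ^ T * (4 ^ T * exp n * B)) := by gcongr
    _ = 2 ^ k * (32 ^ T * exp n * B) := by
      rw [show (32 : ℝ) = 8 * 4 by norm_num, mul_pow]; ring

end DiagonalRecurrence

/-- The discrete primitive of `f` taking the value `c` at `a`. -/
noncomputable def antidifference (a : ℤ) (c : ℝ) (f : ℤ → ℝ) (n : ℤ) : ℝ :=
  c + ∑ j ∈ Finset.Ico a n, f j - ∑ j ∈ Finset.Ico n a, f j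

theorem antidifference_self (a : ℤ) (c : ℝ) (f : ℤ → ℝ) : antidifference a c f a = c := by
  simp [antidifference]

theorem antidifference_add_one_sub (a : ℤ) (c : ℝ) (f : ℤ → ℝ) (n : ℤ) :
    antidifference a c f (n + 1) - antidifference a c f n = f n := by
  unfold antidifference
  rcases le_or_gt a n with h | h
  · have h1 : Finset.Ico a (n + 1) = insert n (Finset.Ico a n) := by
      ext j; simp only [Finset.mem_Ico, Finset.mem_insert]; omega
    rw [h1, Finset.sum_insert (by simp), Finset.Ico_eq_empty (by omega : ¬ n + 1 < a),
      Finset.Ico_eq_empty (by omega : ¬ n < a)]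
    ring
  · have h1 : Finset.Ico n a = insert n (Finset.Ico (n + 1) a) := by
      ext j; simp only [Finset.mem_Ico, Finset.mem_insert]; omega
    rw [h1, Finset.sum_insert (by simp), Finset.Ico_eq_empty (by omega : ¬ a < n + 1),
      Finset.Ico_eq_empty (by omega : ¬ a < n)]
    ring

/-- The solution of the diagonal recurrence with vanishing initial data and value `p t` at the point
`l t` of the `t`-th diagonal. -/
noncomputable def diagonalSolution (l : ℕ → ℤ) (p : ℕ → ℝ) : ℕ → ℤ → ℝ
  | 0 => 0
  | 1 => 0
  | t + 2 => antidifference (l (t + 2)) (p (t + 2)) fun i =>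
      -4 * diagonalSolution l p (t + 1) i + diagonalSolution l p t i -
        diagonalSolution l p t (i - 1)

theorem diagonalRecurrence_diagonalSolution (l : ℕ → ℤ) (p : ℕ → ℝ) :
    DiagonalRecurrence (diagonalSolution l p) := by
  intro t i
  rw [diagonalSolution, antidifference_add_one_sub]

theorem diagonalSolution_apply (l : ℕ → ℤ) (p : ℕ → ℝ) (t : ℕ) :
    diagonalSolution l p (t + 2) (l (t + 2)) = p (t + 2) := by
  rw [diagonalSolution, antidifference_self]

/-- Boundedness of the Goursat problem in a tilted rectangle with data on two initial diagonals and
zero data on the left side. -/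
theorem abs_le_of_left_eq_zero {Z : ℕ → ℤ → ℝ} {T : ℕ} {c d : ℤ} {M : ℝ} (hM : 0 ≤ M)
    (hrec : ∀ (t : ℕ) (i : ℤ), t + 2 ≤ T → c + 1 ≤ 2 * i - (t + 1) → 2 * i - (t + 1) ≤ d - 1 →
      Z (t + 2) (i + 1) - Z (t + 2) i = -4 * Z (t + 1) i + Z t i - Z t (i - 1))
    (h01 : ∀ t : ℕ, t ≤ 1 → ∀ i : ℤ, c ≤ 2 * i - t → 2 * i - t ≤ d → |Z t i| ≤ M)
    (hleft : ∀ t : ℕ, Z (t + 2) ((c + (t + 2) + 1) / 2) = 0) (k : ℕ) :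
    ∀ (t : ℕ) (i : ℤ), t ≤ T → c ≤ 2 * i - t → 2 * i - t ≤ d → t + (i - (c + 1) / 2) ≤ k →
      |Z t i| ≤ 7 ^ k * M := by
  induction k with
  | zero =>
    intro t i _ h1 h2 h3
    simpa using h01 t (by omega) i h1 h2
  | succ k ih =>
    intro t i ht h1 h2 h3
    have hpow : (1 : ℝ) ≤ 7 ^ (k + 1) := one_le_pow₀ (by norm_num)
    match t with
    | 0 => exact (h01 0 (by omega) i h1 h2).trans (le_mul_of_one_le_left hM hpow)
    | 1 => exact (h01 1 (by omega) i h1 h2).trans (le_mul_of_one_le_left hM hpow)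
    | t + 2 =>
      push_cast at h1 h2 h3
      by_cases hi : i = (c + (t + 2) + 1) / 2
      · rw [hi, hleft t, abs_zero]; positivity
      · have h := hrec t (i - 1) ht (by omega) (by omega)
        rw [sub_add_cancel] at h
        have e1 := ih (t + 2) (i - 1) ht (by push_cast; omega) (by push_cast; omega)
          (by push_cast; omega)
        have e2 := ih (t + 1) (i - 1) (by omega) (by push_cast; omega) (by push_cast; omega)
          (by push_cast; omega)
        have e3 := ih t (i - 1) (by omega) (by omega) (by omega) (by omega)
        have e4 := ih t (i - 1 - 1) (by omega) (by omega) (by omega) (by omega)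
        rw [pow_succ]
        rw [abs_le] at *
        constructor <;> linarith [e1.1, e1.2, e2.1, e2.2, e3.1, e3.2, e4.1, e4.2]

/-- **Propagation across a tilted rectangle.** A solution of the diagonal recurrence which is bounded
on two adjacent diagonals, and at `T` points of the `T`-th diagonal, is bounded with exponential
loss on the whole rectangle. -/
theorem abs_le_of_nodes_on_diagonal {v : ℕ → ℤ → ℝ} {T n : ℕ} {c d : ℤ} {M : ℝ} (hM : 0 ≤ M)
    (hT : 0 < T) (hn : d - c ≤ 2 * n)
    (hrec : ∀ (t : ℕ) (i : ℤ), t + 2 ≤ T → c + 1 ≤ 2 * i - (t + 1) → 2 * i - (t + 1) ≤ d - 1 →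
      v (t + 2) (i + 1) - v (t + 2) i = -4 * v (t + 1) i + v t i - v t (i - 1))
    (h01 : ∀ t : ℕ, t ≤ 1 → ∀ i : ℤ, c ≤ 2 * i - t → 2 * i - t ≤ d → |v t i| ≤ M)
    (G : Finset ℤ) (hG : T ≤ G.card)
    (hGT : ∀ i ∈ G, c ≤ 2 * i - T ∧ 2 * i - T ≤ d ∧ |v T i| ≤ M)
    {t : ℕ} {i : ℤ} (ht : t ≤ T) (hc : c ≤ 2 * i - t) (hd : 2 * i - t ≤ d) :
    |v t i| ≤ 10000 ^ (T + n) * M := by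
  set l : ℕ → ℤ := fun t => (c + t + 1) / 2 with hl
  set W := diagonalSolution l fun t => v t (l t) with hWdef
  have hW : DiagonalRecurrence W := diagonalRecurrence_diagonalSolution _ _
  have hW0 : W 0 = 0 := by rw [hWdef, diagonalSolution]
  have hW1 : W 1 = 0 := by rw [hWdef, diagonalSolution]
  have hZ : ∀ (t : ℕ) (i : ℤ), t ≤ T → c ≤ 2 * i - t → 2 * i - t ≤ d →
      |v t i - W t i| ≤ 7 ^ (2 * T + n) * M := by
    intro t i ht h1 h2
    refine abs_le_of_left_eq_zero (Z := fun t i => v t i - W t i) hM ?_ ?_ ?_ (2 * T + n) t i ht h1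
      h2 (by push_cast; omega)
    · intro t i h1 h2 h3
      have e1 := hrec t i h1 h2 h3
      have e2 := hW t i
      linarith
    · intro t ht i h1 h2
      have hWt : W t i = 0 := by
        interval_cases t
        · rw [hW0]; rfl
        · rw [hW1]; rfl
      simpa [hWt] using h01 t ht i h1 h2
    · intro t
      have := diagonalSolution_apply l (fun t => v t (l t)) t
      rw [← hWdef] at this
      have hlt : l (t + 2) = (c + (t + 2) + 1) / 2 := by simp only [hl]; push_cast; rfl
      rw [← hlt, this, sub_self]
  have h7 : (1 : ℝ) ≤ 7 ^ (2 * T + n) := one_le_pow₀ (by norm_num)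
  have hWT : ∀ j ∈ G, |W T j| ≤ 2 * (7 ^ (2 * T + n) * M) := by
    intro j hj
    obtain ⟨h1, h2, h3⟩ := hGT j hj
    have e1 := hZ T j le_rfl h1 h2
    have e2 := le_mul_of_one_le_left hM h7
    rw [abs_le] at *
    constructor <;> linarith [e1.1, e1.2, h3.1, h3.2]
  have hGl : ∀ j ∈ G, l T ≤ j ∧ j ≤ l T + n := by
    intro j hj
    obtain ⟨h1, h2, -⟩ := hGT j hj
    simp only [hl]
    omega
  have hWt := hW.abs_le hW0 hW1 hT (l T) n _ G hG hGl hWT ht (i := i) (k := T + n)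
    (by rw [abs_le]; simp only [hl]; push_cast; omega)
  have hZt := hZ t i ht hc hd
  have hexp : exp (n : ℝ) ≤ 3 ^ n := by
    rw [← exp_one_pow]
    exact pow_le_pow_left₀ (exp_pos _).le (exp_one_lt_d9.le.trans (by norm_num)) n
  have hX : (1 : ℝ) ≤ 2 ^ (T + n) * (32 ^ T * 3 ^ n) := by
    have h1 : (1 : ℝ) ≤ 2 ^ (T + n) := one_le_pow₀ (by norm_num)
    have h2 : (1 : ℝ) ≤ 32 ^ T := one_le_pow₀ (by norm_num)
    have h3 : (1 : ℝ) ≤ 3 ^ n := one_le_pow₀ (by norm_num)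
    exact one_le_mul_of_one_le_of_one_le h1 (one_le_mul_of_one_le_of_one_le h2 h3)
  have h3T : (3 : ℝ) ≤ 3 ^ T := by
    simpa using pow_le_pow_right₀ (by norm_num : (1 : ℝ) ≤ 3) hT
  calc |v t i| = |(v t i - W t i) + W t i| := by rw [sub_add_cancel]
    _ ≤ |v t i - W t i| + |W t i| := abs_add_le _ _
    _ ≤ 7 ^ (2 * T + n) * M +
        2 ^ (T + n) * (32 ^ T * 3 ^ n * (2 * (7 ^ (2 * T + n) * M))) := by
      refine add_le_add hZt (hWt.trans ?_)
      gcongr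
    _ = (1 + 2 * (2 ^ (T + n) * (32 ^ T * 3 ^ n))) * (7 ^ (2 * T + n) * M) := by ring
    _ ≤ (3 ^ T * (2 ^ (T + n) * (32 ^ T * 3 ^ n))) * (7 ^ (2 * T + n) * M) := by
      gcongr
      nlinarith
    _ = (9408 ^ T * 42 ^ n) * M := by
      rw [pow_add, pow_add, pow_mul, show (9408 : ℝ) = 3 * 2 * 32 * 7 ^ 2 by norm_num,
        show (42 : ℝ) = 2 * 3 * 7 by norm_num]
      simp only [mul_pow]
      ring
    _ ≤ (10000 ^ T * 10000 ^ n) * M := by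
      gcongr <;> norm_num
    _ = 10000 ^ (T + n) * M := by rw [pow_add]

/-- The tilted rectangle with sides parallel to the diagonals of the lattice. -/
def tiltedRect (s₁ s₂ t₁ t₂ : ℤ) : Set (ℤ × ℤ) :=
  {p | s₁ ≤ p.1 - p.2 ∧ p.1 - p.2 ≤ s₂ ∧ t₁ ≤ p.1 + p.2 ∧ p.1 + p.2 ≤ t₂}

theorem tiltedRect_mono {s₁ s₂ t₁ t₂ s₁' s₂' t₁' t₂' : ℤ} (h1 : s₁' ≤ s₁) (h2 : s₂ ≤ s₂')
    (h3 : t₁' ≤ t₁) (h4 : t₂ ≤ t₂') : tiltedRect s₁ s₂ t₁ t₂ ⊆ tiltedRect s₁' s₂' t₁' t₂' :=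
  fun _ hp => ⟨h1.trans hp.1, hp.2.1.trans h2, h3.trans hp.2.2.1, hp.2.2.2.trans h4⟩

/-- `u` is lattice harmonic on `R`, and bounded by `θ` on `R` outside the exceptional set `F`. -/
def TameOn (u : ℤ × ℤ → ℝ) (θ : ℝ) (F : Finset (ℤ × ℤ)) (R : Set (ℤ × ℤ)) : Prop :=
  ∀ p ∈ R, discreteLaplacian u p = 0 ∧ (p ∉ F → |u p| ≤ θ)

theorem TameOn.mono {u : ℤ × ℤ → ℝ} {θ : ℝ} {F : Finset (ℤ × ℤ)} {R R' : Set (ℤ × ℤ)}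
    (h : TameOn u θ F R) (hR : R' ⊆ R) : TameOn u θ F R' :=
  fun p hp => h p (hR hp)

theorem TameOn.comp {u : ℤ × ℤ → ℝ} {θ : ℝ} {F : Finset (ℤ × ℤ)} {R R' : Set (ℤ × ℤ)}
    (h : TameOn u θ F R) {σ : ℤ × ℤ → ℤ × ℤ} (hσ : Function.Involutive σ)
    (hlap : ∀ p, discreteLaplacian (u ∘ σ) p = discreteLaplacian u (σ p))
    (hR : ∀ p ∈ R', σ p ∈ R) : TameOn (u ∘ σ) θ (F.image σ) R' := by
  intro p hp
  obtain ⟨h1, h2⟩ := h (σ p) (hR p hp)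
  refine ⟨by rw [hlap, h1], fun hpF => h2 fun hF => hpF ?_⟩
  exact Finset.mem_image.2 ⟨σ p, hF, hσ p⟩

/-- Extension of a bound from a tilted rectangle to a longer one in the direction `x + y → ∞`. -/
theorem abs_le_extend {u : ℤ × ℤ → ℝ} {θ M : ℝ} {F : Finset (ℤ × ℤ)} {s₁ s₂ t₁ t₂ : ℤ} {δ : ℕ}
    (hθM : θ ≤ M) (hM : 0 ≤ M) (hs : 8 * δ ≤ s₂ - s₁) (hs' : s₂ - s₁ ≤ 64 * δ)
    (ht : t₁ < t₂) (hF : F.card < 2 * δ ^ 2) (hu : TameOn u θ F (tiltedRect s₁ s₂ t₁ (t₂ + 2 * δ)))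
    (hb : ∀ p ∈ tiltedRect s₁ s₂ t₁ t₂, |u p| ≤ M) :
    ∀ p ∈ tiltedRect s₁ s₂ t₁ (t₂ + δ), |u p| ≤ 10000 ^ (34 * δ) * M := by
  classical
  obtain ⟨τ, hτ, hτF⟩ : ∃ τ ∈ Finset.Ico (t₂ + δ) (t₂ + 2 * δ),
      (F.filter fun p => p.1 + p.2 = τ).card < 2 * δ := by
    refine Finset.exists_card_fiber_lt_of_card_lt_mul ?_
    rw [Int.card_Ico, show (t₂ + 2 * δ - (t₂ + δ)).toNat = δ by omega]
    nlinarith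
  rw [Finset.mem_Ico] at hτ
  obtain ⟨T, rfl⟩ : ∃ T : ℕ, τ = t₂ - 1 + T := ⟨(τ - (t₂ - 1)).toNat, by omega⟩
  set v : ℕ → ℤ → ℝ := fun k i => (-1) ^ i * u (i, t₂ - 1 + k - i) with hv
  have habs : ∀ k i, |v k i| = |u (i, t₂ - 1 + k - i)| := fun k i => by
    simp [hv, abs_mul, abs_zpow]
  have hrec : ∀ (k : ℕ) (i : ℤ), k + 2 ≤ T → s₁ + t₂ - 1 + 1 ≤ 2 * i - (k + 1) →
      2 * i - (k + 1) ≤ s₂ + t₂ - 1 - 1 →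
      v (k + 2) (i + 1) - v (k + 2) i = -4 * v (k + 1) i + v k i - v k (i - 1) := by
    intro k i hk h1 h2
    have hlap := (hu (i, t₂ - 1 + (k + 1) - i)
      ⟨by simp only; omega, by simp only; omega, by simp only; omega, by simp only; omega⟩).1
    simp only [discreteLaplacian] at hlap
    simp only [hv]
    rw [zpow_add_one₀ (by norm_num), zpow_sub_one₀ (by norm_num)]
    push_cast
    rw [show t₂ - 1 + ((k : ℤ) + 1) - i + 1 = t₂ - 1 + (k + 2) - i by ring,
      show t₂ - 1 + ((k : ℤ) + 1) - i - 1 = t₂ - 1 + k - i by ring] at hlap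
    rw [show t₂ - 1 + ((k : ℤ) + 2) - (i + 1) = t₂ - 1 + (k + 1) - i by ring,
      show t₂ - 1 + (k : ℤ) - (i - 1) = t₂ - 1 + (k + 1) - i by ring]
    rw [show ((-1 : ℝ))⁻¹ = -1 by norm_num]
    linear_combination (-(-1 : ℝ) ^ i) * hlap
  have h01 : ∀ k : ℕ, k ≤ 1 → ∀ i : ℤ, s₁ + t₂ - 1 ≤ 2 * i - k → 2 * i - k ≤ s₂ + t₂ - 1 →
      |v k i| ≤ M := by
    intro k hk i h1 h2
    rw [habs]
    exact hb _ ⟨by simp only; omega, by simp only; omega, by simp only; omega,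
      by simp only; omega⟩
  set I := Finset.Icc ((s₁ + t₂ - 1 + T + 1) / 2) ((s₂ + t₂ - 1 + T) / 2) with hI
  set E := (F.filter fun p => p.1 + p.2 = t₂ - 1 + T).image Prod.fst with hE
  have hEcard : E.card < 2 * δ := Finset.card_image_le.trans_lt hτF
  have hIcard : 4 * δ ≤ I.card := by rw [hI, Int.card_Icc]; omega
  have hGcard : T ≤ (I \ E).card := by
    have := Finset.le_card_sdiff E I
    omega
  have hG : ∀ i ∈ I \ E, s₁ + t₂ - 1 ≤ 2 * i - T ∧ 2 * i - T ≤ s₂ + t₂ - 1 ∧ |v T i| ≤ M := by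
    intro i hi
    rw [Finset.mem_sdiff, hI, Finset.mem_Icc] at hi
    obtain ⟨⟨h1, h2⟩, h3⟩ := hi
    refine ⟨by omega, by omega, ?_⟩
    rw [habs]
    refine ((hu _ ⟨by simp only; omega, by simp only; omega, by simp only; omega,
      by simp only; omega⟩).2 fun hmem => h3 ?_).trans hθM
    exact Finset.mem_image.2 ⟨_, Finset.mem_filter.2 ⟨hmem, by simp only; omega⟩, rfl⟩
  rintro ⟨x, y⟩ ⟨h1, h2, h3, h4⟩
  simp only at h1 h2 h3 h4
  have hpow : (1 : ℝ) ≤ 10000 ^ (34 * δ) := one_le_pow₀ (by norm_num)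
  rcases le_or_gt (x + y) t₂ with h | h
  · exact (hb (x, y) ⟨h1, h2, h3, h⟩).trans (le_mul_of_one_le_left hM hpow)
  · obtain ⟨k, hk⟩ : ∃ k : ℕ, x + y = t₂ - 1 + k := ⟨(x + y - (t₂ - 1)).toNat, by omega⟩
    have := abs_le_of_nodes_on_diagonal (n := 32 * δ) (t := k) (i := x) hM
      (by omega) (by push_cast; omega) hrec h01 (I \ E) hGcard hG (by omega) (by omega) (by omega)
    rw [habs, show t₂ - 1 + (k : ℤ) - x = y by omega] at this
    refine this.trans ?_
    gcongr
    · norm_num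
    · omega

theorem abs_le_extend_iterate {u : ℤ × ℤ → ℝ} {θ M : ℝ} {F : Finset (ℤ × ℤ)}
    {s₁ s₂ t₁ t₂ t₃ : ℤ} {δ : ℕ} (hδ : 0 < δ) (hθM : θ ≤ M) (hM : 0 ≤ M)
    (hs : 8 * δ ≤ s₂ - s₁) (hs' : s₂ - s₁ ≤ 64 * δ) (ht : t₁ < t₂) (hF : F.card < 2 * δ ^ 2)
    (hu : TameOn u θ F (tiltedRect s₁ s₂ t₁ t₃))
    (hb : ∀ p ∈ tiltedRect s₁ s₂ t₁ t₂, |u p| ≤ M) (j : ℕ) (hj : t₂ + (j + 1) * δ ≤ t₃) :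
    ∀ p ∈ tiltedRect s₁ s₂ t₁ (t₂ + j * δ), |u p| ≤ 10000 ^ (34 * δ * j) * M := by
  induction j with
  | zero => simpa using hb
  | succ j ih =>
    push_cast at hj ⊢
    have hprev := ih (by nlinarith)
    have hpow : (1 : ℝ) ≤ 10000 ^ (34 * δ * j) := one_le_pow₀ (by norm_num)
    have hle : M ≤ 10000 ^ (34 * δ * j) * M := le_mul_of_one_le_left hM hpow
    have := abs_le_extend (hθM.trans hle) (by positivity) hs hs' (t₁ := t₁)
      (t₂ := t₂ + j * δ) (by nlinarith) hF
      (hu.mono (tiltedRect_mono le_rfl le_rfl le_rfl (by linarith))) hprev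
    rw [show t₂ + (j : ℤ) * δ + δ = t₂ + (j + 1) * δ by ring] at this
    intro p hp
    refine (this p hp).trans_eq ?_
    rw [← mul_assoc, ← pow_add]
    ring_nf

/-- Extension of a bound from a tilted rectangle to the middle half of the range of `x + y`. -/
theorem abs_le_fill_add {u : ℤ × ℤ → ℝ} {θ M : ℝ} {F : Finset (ℤ × ℤ)} {s₁ s₂ t₀ t₁ : ℤ} {δ : ℕ}
    (hδ : 0 < δ) (hθM : θ ≤ M) (hM : 0 ≤ M) (hs : 8 * δ ≤ s₂ - s₁) (hs' : s₂ - s₁ ≤ 64 * δ)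
    (hF : F.card < 2 * δ ^ 2) (hu : TameOn u θ F (tiltedRect s₁ s₂ t₀ (t₀ + 64 * δ - 1)))
    (ht : t₁ = t₀ + 8 * δ ∨ t₁ = t₀ + 40 * δ)
    (hb : ∀ p ∈ tiltedRect s₁ s₂ t₁ (t₁ + 16 * δ - 1), |u p| ≤ M) :
    ∀ p ∈ tiltedRect s₁ s₂ (t₀ + 16 * δ) (t₀ + 48 * δ - 1), |u p| ≤ 10000 ^ (816 * δ) * M := by
  rcases ht with rfl | rfl
  · have := abs_le_extend_iterate hδ hθM hM hs hs' (by omega) hF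
      (hu.mono (tiltedRect_mono (t₁ := t₀ + 8 * δ) le_rfl le_rfl (by omega) le_rfl)) hb 24
      (by push_cast; omega)
    rw [show 34 * δ * 24 = 816 * δ by ring] at this
    exact fun p hp => this p (tiltedRect_mono le_rfl le_rfl (by omega) (by push_cast; omega) hp)
  · set σ : ℤ × ℤ → ℤ × ℤ := fun p => (-p.2, -p.1) with hσ
    have hinv : Function.Involutive σ := fun p => by simp [hσ]
    have hlap : ∀ p, discreteLaplacian (u ∘ σ) p = discreteLaplacian u (σ p) := fun p => by
      simp only [discreteLaplacian, hσ, Function.comp_apply]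
      rw [show -(p.2 + 1) = -p.2 - 1 by ring, show -(p.1 + 1) = -p.1 - 1 by ring,
        show -(p.2 - 1) = -p.2 + 1 by ring, show -(p.1 - 1) = -p.1 + 1 by ring]
      ring
    have hmem : ∀ a b : ℤ, ∀ p ∈ tiltedRect s₁ s₂ (-b) (-a), σ p ∈ tiltedRect s₁ s₂ a b := by
      rintro a b p ⟨h1, h2, h3, h4⟩
      exact ⟨by simp only [hσ]; omega, by simp only [hσ]; omega, by simp only [hσ]; omega,
        by simp only [hσ]; omega⟩
    have := abs_le_extend_iterate (u := u ∘ σ) hδ hθM hM hs hs' (by omega)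
      (Finset.card_image_le.trans_lt hF)
      ((hu.comp hinv hlap (hmem _ _)).mono (tiltedRect_mono
        (t₁ := -(t₀ + 40 * δ + 16 * δ - 1)) le_rfl le_rfl (by omega) le_rfl))
      (fun p hp => hb _ (hmem _ _ p hp)) 24 (by push_cast; omega)
    rw [show 34 * δ * 24 = 816 * δ by ring] at this
    rintro p ⟨h1, h2, h3, h4⟩
    have hp := this (σ p) ⟨by simp only [hσ]; omega, by simp only [hσ]; omega,
      by simp only [hσ]; omega, by simp only [hσ]; push_cast; omega⟩
    rwa [Function.comp_apply, hinv p] at hp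

/-- Extension of a bound from a tilted rectangle to the middle half of the range of `x - y`. -/
theorem abs_le_fill_sub {u : ℤ × ℤ → ℝ} {θ M : ℝ} {F : Finset (ℤ × ℤ)} {s₀ s₁ t₁ t₂ : ℤ} {δ : ℕ}
    (hδ : 0 < δ) (hθM : θ ≤ M) (hM : 0 ≤ M) (ht : 8 * δ ≤ t₂ - t₁) (ht' : t₂ - t₁ ≤ 64 * δ)
    (hF : F.card < 2 * δ ^ 2) (hu : TameOn u θ F (tiltedRect s₀ (s₀ + 64 * δ - 1) t₁ t₂))
    (hs : s₁ = s₀ + 8 * δ ∨ s₁ = s₀ + 40 * δ)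
    (hb : ∀ p ∈ tiltedRect s₁ (s₁ + 16 * δ - 1) t₁ t₂, |u p| ≤ M) :
    ∀ p ∈ tiltedRect (s₀ + 16 * δ) (s₀ + 48 * δ - 1) t₁ t₂, |u p| ≤ 10000 ^ (816 * δ) * M := by
  set σ : ℤ × ℤ → ℤ × ℤ := fun p => (p.1, -p.2) with hσ
  have hinv : Function.Involutive σ := fun p => by simp [hσ]
  have hlap : ∀ p, discreteLaplacian (u ∘ σ) p = discreteLaplacian u (σ p) := fun p => by
    simp only [discreteLaplacian, hσ, Function.comp_apply]
    rw [show -(p.2 + 1) = -p.2 - 1 by ring, show -(p.2 - 1) = -p.2 + 1 by ring]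
    ring
  have hmem : ∀ a b c d : ℤ, ∀ p ∈ tiltedRect c d a b, σ p ∈ tiltedRect a b c d := by
    rintro a b c d p ⟨h1, h2, h3, h4⟩
    exact ⟨by simp only [hσ]; omega, by simp only [hσ]; omega, by simp only [hσ]; omega,
      by simp only [hσ]; omega⟩
  have := abs_le_fill_add (u := u ∘ σ) hδ hθM hM ht ht' (Finset.card_image_le.trans_lt hF)
    (hu.comp hinv hlap (hmem _ _ _ _)) hs (fun p hp => hb _ (hmem _ _ _ _ p hp))
  intro p hp
  have hp' := this (σ p) (hmem _ _ _ _ p hp)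
  rwa [Function.comp_apply, hinv p] at hp'

/-- **Multiscale propagation.** If a lattice harmonic function is bounded by `θ` on a tilted square
of side `2 ^ k` outside a set of small density, then it is bounded on the middle half of the
square, with a loss exponential in the side length. -/
theorem abs_le_on_middle {u : ℤ × ℤ → ℝ} {θ : ℝ} (hθ : 0 ≤ θ) (k : ℕ) :
    ∀ (s t : ℤ) (F : Finset (ℤ × ℤ)), F.card * 4096 ≤ (2 ^ k) ^ 2 →
      TameOn u θ F (tiltedRect s (s + 2 ^ k - 1) t (t + 2 ^ k - 1)) →
      ∀ x y : ℤ, 2 ^ k ≤ 4 * (x - y - s) → 4 * (x - y - s) < 3 * 2 ^ k →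
        2 ^ k ≤ 4 * (x + y - t) → 4 * (x + y - t) < 3 * 2 ^ k →
        |u (x, y)| ≤ (10000 ^ 51) ^ 2 ^ k * θ := by
  classical
  induction k with
  | zero => intro s t F hF hu x y h1 h2; omega
  | succ k ih =>
    intro s t F hF hu x y h1 h2 h3 h4
    rcases lt_or_ge k 5 with hk | hk
    · have hpow : (2 : ℕ) ^ (k + 1) ≤ 2 ^ 5 := Nat.pow_le_pow_right (by norm_num) (by omega)
      have hF0 : F = ∅ := by
        rw [← Finset.card_eq_zero]
        have := Nat.pow_le_pow_left hpow 2
        omega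
      have hone : (1 : ℝ) ≤ (10000 ^ 51) ^ 2 ^ (k + 1) := one_le_pow₀ (one_le_pow₀ (by norm_num))
      have hp : (0 : ℤ) < 2 ^ (k + 1) := by positivity
      refine ((hu (x, y) ⟨?_, ?_, ?_, ?_⟩).2 (by simp [hF0])).trans
        (le_mul_of_one_le_left hθ hone) <;> simp only <;> omega
    · obtain ⟨m, rfl⟩ := Nat.exists_eq_add_of_le hk
      set δ : ℕ := 2 ^ m with hδdef
      have hδ : 0 < δ := by positivity
      have hkN : 2 ^ (5 + m) = 32 * δ := by rw [pow_add, hδdef]; norm_num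
      have hkN' : 2 ^ (5 + m + 1) = 64 * δ := by rw [pow_succ, hkN]; ring
      have hkZ : (2 : ℤ) ^ (5 + m) = 32 * δ := by exact_mod_cast hkN
      have hkZ' : (2 : ℤ) ^ (5 + m + 1) = 64 * δ := by exact_mod_cast hkN'
      rw [hkN'] at hF
      rw [hkZ'] at hu h1 h2 h3 h4
      rw [hkN']
      simp only [hkN, hkZ] at ih
      obtain ⟨a, b, ha, hb, hcard⟩ : ∃ a b : ℤ, (a = s ∨ a = s + 32 * δ) ∧
          (b = t ∨ b = t + 32 * δ) ∧
          (F.filter (· ∈ tiltedRect a (a + 32 * δ - 1) b (b + 32 * δ - 1))).card * 4096 ≤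
            (32 * δ) ^ 2 := by
        by_contra! hcon
        have c1 := hcon s t (.inl rfl) (.inl rfl)
        have c2 := hcon s (t + 32 * δ) (.inl rfl) (.inr rfl)
        have c3 := hcon (s + 32 * δ) t (.inr rfl) (.inl rfl)
        have c4 := hcon (s + 32 * δ) (t + 32 * δ) (.inr rfl) (.inr rfl)
        set Q : ℤ → ℤ → Finset (ℤ × ℤ) := fun a b =>
          F.filter (· ∈ tiltedRect a (a + 32 * δ - 1) b (b + 32 * δ - 1)) with hQ
        have hdisj : ∀ a b a' b' : ℤ, a + 32 * δ ≤ a' ∨ b + 32 * δ ≤ b' →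
            Disjoint (Q a b) (Q a' b') := by
          intro a b a' b' hab
          rw [Finset.disjoint_left]
          intro p hp hp'
          obtain ⟨-, h1, h2, h3, h4⟩ := Finset.mem_filter.1 hp
          obtain ⟨-, h1', h2', h3', h4'⟩ := Finset.mem_filter.1 hp'
          omega
        have hd1 := Finset.card_union_of_disjoint (hdisj s t s (t + 32 * δ) (.inr le_rfl))
        have hd2 := Finset.card_union_of_disjoint
          (hdisj (s + 32 * δ) t (s + 32 * δ) (t + 32 * δ) (.inr le_rfl))
        have hd3 : Disjoint (Q s t ∪ Q s (t + 32 * δ))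
            (Q (s + 32 * δ) t ∪ Q (s + 32 * δ) (t + 32 * δ)) := by
          simp only [Finset.disjoint_union_left, Finset.disjoint_union_right]
          exact ⟨⟨hdisj _ _ _ _ (.inl le_rfl), hdisj _ _ _ _ (.inl le_rfl)⟩,
            hdisj _ _ _ _ (.inl le_rfl), hdisj _ _ _ _ (.inl le_rfl)⟩
        have hd3' := Finset.card_union_of_disjoint hd3
        have hsub : (Q s t ∪ Q s (t + 32 * δ)) ∪
            (Q (s + 32 * δ) t ∪ Q (s + 32 * δ) (t + 32 * δ)) ⊆ F :=
          Finset.union_subset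
            (Finset.union_subset (Finset.filter_subset _ _) (Finset.filter_subset _ _))
            (Finset.union_subset (Finset.filter_subset _ _) (Finset.filter_subset _ _))
        have hle := Finset.card_le_card hsub
        nlinarith
      have hF2 : F.card < 2 * δ ^ 2 := by nlinarith
      set M : ℝ := (10000 ^ 51) ^ (32 * δ) * θ with hMdef
      have hθM : θ ≤ M := le_mul_of_one_le_left hθ (one_le_pow₀ (one_le_pow₀ (by norm_num)))
      have hM : 0 ≤ M := hθ.trans hθM
      have hsmall : TameOn u θ
          (F.filter (· ∈ tiltedRect a (a + 32 * δ - 1) b (b + 32 * δ - 1)))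
          (tiltedRect a (a + 32 * δ - 1) b (b + 32 * δ - 1)) := by
        intro p hp
        obtain ⟨e1, e2⟩ := hu p (tiltedRect_mono (by omega) (by omega) (by omega) (by omega) hp)
        exact ⟨e1, fun hpF => e2 fun h => hpF (Finset.mem_filter.2 ⟨h, hp⟩)⟩
      have hcore : ∀ p ∈ tiltedRect (a + 8 * δ) (a + 8 * δ + 16 * δ - 1) (b + 8 * δ)
          (b + 8 * δ + 16 * δ - 1), |u p| ≤ M := by
        rintro ⟨x, y⟩ ⟨e1, e2, e3, e4⟩
        simp only at e1 e2 e3 e4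
        exact ih a b _ hcard hsmall x y (by omega) (by omega) (by omega) (by omega)
      have hcol := abs_le_fill_add hδ hθM hM (by omega) (by omega) hF2
        (hu.mono (tiltedRect_mono (by omega) (by omega) le_rfl le_rfl)) (by omega) hcore
      have hpow : (1 : ℝ) ≤ 10000 ^ (816 * δ) := one_le_pow₀ (by norm_num)
      have hfull := abs_le_fill_sub hδ (hθM.trans (le_mul_of_one_le_left hM hpow))
        (by positivity) (by omega) (by omega) hF2
        (hu.mono (tiltedRect_mono le_rfl le_rfl (by omega) (by omega))) (by omega) hcol
      refine (hfull (x, y) ⟨by simp only; omega, by simp only; omega, by simp only; omega,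
        by simp only; omega⟩).trans_eq ?_
      rw [hMdef, ← pow_mul, ← pow_mul, ← mul_assoc, ← mul_assoc, ← pow_add, ← pow_add]
      congr 2
      ring

/-- The function is controlled on the whole half square by a bound holding on most of the square. -/
theorem abs_le_on_latticeHalfSquare {u : ℤ × ℤ → ℝ} {θ : ℝ} (hθ : 0 ≤ θ) {L : ℕ} {a b : ℤ}
    (hL : 8 ≤ L) {F : Finset (ℤ × ℤ)} (hF : (F.card : ℝ) < 1 / 2 ^ 18 * (L : ℝ) ^ 2)
    (hu : TameOn u θ F (latticeSquare a b L)) :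
    ∀ p ∈ latticeHalfSquare a b L, |u p| ≤ (10000 ^ 51) ^ L * θ := by
  rintro ⟨x, y⟩ ⟨h1, h2, h3, h4⟩
  replace h1 : 4 * a + L ≤ 4 * x := by
    have : (4 * a + L : ℝ) ≤ 4 * x := by simp only at h1; linarith
    exact_mod_cast this
  replace h2 : 4 * x < 4 * a + 3 * L := by
    have : (4 * x : ℝ) < 4 * a + 3 * L := by simp only at h2; linarith
    exact_mod_cast this
  replace h3 : 4 * b + L ≤ 4 * y := by
    have : (4 * b + L : ℝ) ≤ 4 * y := by simp only at h3; linarith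
    exact_mod_cast this
  replace h4 : 4 * y < 4 * b + 3 * L := by
    have : (4 * y : ℝ) < 4 * b + 3 * L := by simp only at h4; linarith
    exact_mod_cast this
  obtain ⟨k, hk⟩ : ∃ k, Nat.log 2 (L / 2) = k + 1 :=
    Nat.exists_eq_add_one.2 (Nat.log_pos (by norm_num) (by omega))
  have hle : 2 ^ (k + 1) ≤ L / 2 := hk ▸ Nat.pow_log_le_self 2 (by omega)
  have hlt : L / 2 < 2 ^ (k + 1 + 1) := hk ▸ Nat.lt_pow_succ_log_self (by norm_num) _
  set h : ℕ := 2 ^ k with hh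
  have hpos : 0 < h := by positivity
  have hN : 2 ^ (k + 1) = 2 * h := by rw [pow_succ]; ring
  have hZ : (2 : ℤ) ^ (k + 1) = 2 * h := by exact_mod_cast hN
  have hlt' : L < 8 * h := by rw [pow_succ, hN] at hlt; omega
  rw [hN] at hle
  have hcard : F.card * 4096 ≤ (2 ^ (k + 1)) ^ 2 := by
    rw [hN]
    have hlR : (L : ℝ) < 8 * h := by exact_mod_cast hlt'
    have hsq : (L : ℝ) ^ 2 ≤ (8 * h) ^ 2 := by gcongr
    have : (F.card : ℝ) * 4096 ≤ (2 * h) ^ 2 := by linarith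
    exact_mod_cast this
  have hmid := abs_le_on_middle hθ (k + 1) (x - y - h) (x + y - h) F hcard
    (hu.mono ?_) x y (by omega) (by omega) (by omega) (by omega)
  · refine hmid.trans (mul_le_mul_of_nonneg_right ?_ hθ)
    exact pow_le_pow_right₀ (one_le_pow₀ (by norm_num)) (by omega)
  · rintro ⟨p, q⟩ ⟨g1, g2, g3, g4⟩
    rw [hZ] at g2 g4
    simp only at g1 g2 g3 g4
    refine ⟨?_, ?_, ?_, ?_⟩ <;> simp only <;> omega

theorem latticeSquare_eq_coe (a b : ℤ) (L : ℕ) :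
    latticeSquare a b L = (Finset.Ico a (a + L) ×ˢ Finset.Ico b (b + L) : Finset (ℤ × ℤ)) := by
  ext p
  simp [latticeSquare, and_assoc]

/-- **Quantitative unique continuation for lattice harmonic functions on `ℤ²`**
(Buhovsky–Logunov–Malinnikova–Sodin). There are constants `α > 1 > ε > 0` such that any
`u : ℤ² → ℝ` harmonic in a square `Q` of side length `L ≥ α` satisfies
`#{x ∈ Q : |u(x)| ≥ e^{−αL} ‖u‖_{ℓ^∞(½Q)}} ≥ εL²`. -/
theorem blms_lattice_ucp :
    ∃ α ε : ℝ, 1 < α ∧ 0 < ε ∧ ε < 1 ∧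
      ∀ (L : ℕ) (a b : ℤ) (u : ℤ × ℤ → ℝ),
        α ≤ (L : ℝ) →
        (∀ x ∈ latticeSquare a b L, discreteLaplacian u x = 0) →
        ε * (L : ℝ) ^ 2 ≤
          (({x ∈ latticeSquare a b L |
              Real.exp (-α * L) *
                sSup ((fun y => |u y|) '' latticeHalfSquare a b L) ≤ |u x|}).ncard : ℝ) := by
  refine ⟨510000, 1 / 2 ^ 18, by norm_num, by norm_num, by norm_num, ?_⟩
  intro L a b u hL hu
  have hL' : 510000 ≤ L := by exact_mod_cast hL
  set S := sSup ((fun y => |u y|) '' latticeHalfSquare a b L) with hS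
  have hS0 : 0 ≤ S := Real.sSup_nonneg (by rintro _ ⟨y, -, rfl⟩; exact abs_nonneg _)
  set θ := Real.exp (-510000 * L) * S with hθdef
  have hθ : 0 ≤ θ := by positivity
  set A := {x ∈ latticeSquare a b L | θ ≤ |u x|} with hA
  have hfin : A.Finite :=
    Set.Finite.subset (latticeSquare_eq_coe a b L ▸ Finset.finite_toSet _) fun _ hx => hx.1
  by_contra! hcon
  have hbound := abs_le_on_latticeHalfSquare (F := hfin.toFinset) hθ (by omega)
    (by rwa [← Set.ncard_eq_toFinset_card A hfin]) (a := a) (b := b) (u := u) fun p hp =>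
      ⟨hu p hp, fun hpF => le_of_lt (not_le.1 fun hle => hpF (hfin.mem_toFinset.2 ⟨hp, hle⟩))⟩
  have hSle : S ≤ (10000 ^ 51) ^ L * θ :=
    Real.sSup_le (by rintro _ ⟨y, hy, rfl⟩; exact hbound y hy) (by positivity)
  have hexp : (10000 ^ 51 : ℝ) < Real.exp 510000 := by
    rw [show (510000 : ℝ) = (51 : ℕ) * 10000 by norm_num, Real.exp_nat_mul]
    exact pow_lt_pow_left₀ (by linarith [Real.add_one_lt_exp (x := 10000) (by norm_num)])
      (by norm_num) (by norm_num)
  have hfac : (10000 ^ 51 : ℝ) ^ L * Real.exp (-510000 * L) < 1 := by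
    rw [neg_mul, Real.exp_neg, mul_comm (510000 : ℝ), Real.exp_nat_mul, ← div_eq_mul_inv,
      div_lt_one (by positivity)]
    exact pow_lt_pow_left₀ hexp (by positivity) (by omega)
  have hSzero : S = 0 := by
    rw [hθdef, ← mul_assoc] at hSle
    by_contra hne
    have := mul_lt_mul_of_pos_right hfac (hS0.lt_of_ne' hne)
    linarith
  have hAQ : A = latticeSquare a b L := by
    rw [hA, hθdef, hSzero, mul_zero]
    exact Set.sep_eq_self_iff_mem_true.2 fun _ _ => abs_nonneg _
  rw [hAQ, latticeSquare_eq_coe, Set.ncard_coe_finset, Finset.card_product, Int.card_Ico,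
    Int.card_Ico, add_sub_cancel_left, add_sub_cancel_left, Int.toNat_natCast] at hcon
  push_cast at hcon
  nlinarith [sq_nonneg (L : ℝ)]
end
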